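/- For n ≥ 11, the minimum of f(P(n,2),M) over all type-1 perfect matchings M of P(n,2) equals ⌈(n+2)/6⌉. -/

import Mathlib

open SimpleGraph

/-- Vertices of the generalized Petersen graph `P(n,2)`:
`Sum.inl i` is the outer vertex `u_i`, `Sum.inr i` is the inner vertex `v_i`. -/
abbrev PV (n : ℕ) := ZMod n ⊕ ZMod n

/-- The outer vertex `u_i`. -/
def pu {n : ℕ} (i : ZMod n) : PV n := Sum.inl i

/-- The inner vertex `v_i`. -/
def pv {n : ℕ} (i : ZMod n) : PV n := Sum.inr i

/-- The generalized Petersen graph `P(n,2)`, with edges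
`u_i u_{i+2}`, `u_i v_i` (spokes) and `v_i v_{i+1}`, indices mod `n`. -/
def petersen (n : ℕ) : SimpleGraph (PV n) :=
  SimpleGraph.fromRel (fun x y =>
    (∃ i : ZMod n, x = pu i ∧ y = pu (i + 2)) ∨
    (∃ i : ZMod n, x = pu i ∧ y = pv i) ∨
    (∃ i : ZMod n, x = pv i ∧ y = pv (i + 1)))

/-- `S` is a forcing set of the perfect matching `M` of `G`:
`S ⊆ M` and `S` is contained in no other perfect matching of `G`. -/
def IsForcingSet {V : Type*} (G : SimpleGraph V) (M : G.Subgraph) (S : Set (Sym2 V)) : Prop :=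
  S ⊆ M.edgeSet ∧
    ∀ M' : G.Subgraph, M'.IsPerfectMatching → S ⊆ M'.edgeSet → M' = M

/-- The forcing number `f(G,M)`: the minimum cardinality of a forcing set of `M`. -/
noncomputable def forcingNumber {V : Type*} (G : SimpleGraph V) (M : G.Subgraph) : ℕ :=
  sInf {k | ∃ S : Set (Sym2 V), IsForcingSet G M S ∧ S.ncard = k}

/-- Block `A` starting at position `i` (length 4). -/
def blockA (n : ℕ) (i : ZMod n) : Set (Sym2 (PV n)) :=
  {s(pu i, pu (i + 2)), s(pu (i + 1), pu (i + 3)), s(pv i, pv (i + 1)), s(pv (i + 2), pv (i + 3))}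

/-- Block `B` at position `i` (length 1): a single spoke. -/
def blockB (n : ℕ) (i : ZMod n) : Set (Sym2 (PV n)) :=
  {s(pu i, pv i)}

/-- Block `C` starting at position `i` (length 3). -/
def blockC (n : ℕ) (i : ZMod n) : Set (Sym2 (PV n)) :=
  {s(pu i, pu (i + 2)), s(pu (i + 1), pv (i + 1)), s(pv (i + 2), pv (i + 3))}

/-- Block `D` starting at position `i` (length 4). -/
def blockD (n : ℕ) (i : ZMod n) : Set (Sym2 (PV n)) :=
  {s(pu i, pu (i + 2)), s(pu (i + 1), pu (i + 3)), s(pv (i + 1), pv (i + 2)), s(pv (i + 3), pv (i + 4))}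

/-- Length of an `A`/`B` block: `true` codes `A` (length 4), `false` codes `B` (length 1). -/
def abLen (b : Bool) : ℕ := if b then 4 else 1

/-- Edge set of a concatenation of `A`/`B` blocks starting at position `i`. -/
def abEdges (n : ℕ) : ZMod n → List Bool → Set (Sym2 (PV n))
  | _, [] => ∅
  | i, true :: L => blockA n i ∪ abEdges n (i + 4) L
  | i, false :: L => blockB n i ∪ abEdges n (i + 1) L

/-- A perfect matching (given as a subgraph of `P(n,2)`) has type 1 if its edge set is
a cyclic concatenation of `A` and `B` blocks whose lengths sum to `n`. -/
def IsType1 {n : ℕ} (M : (petersen n).Subgraph) : Prop :=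
  ∃ (i : ZMod n) (L : List Bool), (L.map abLen).sum = n ∧ M.edgeSet = abEdges n i L

/-- Length of a `C`/`D` block: `true` codes `C` (length 3), `false` codes `D` (length 4). -/
def cdLen (b : Bool) : ℕ := if b then 3 else 4

/-- Edge set of a concatenation of `C`/`D` blocks starting at position `i`. -/
def cdEdges (n : ℕ) : ZMod n → List Bool → Set (Sym2 (PV n))
  | _, [] => ∅
  | i, true :: L => blockC n i ∪ cdEdges n (i + 3) L
  | i, false :: L => blockD n i ∪ cdEdges n (i + 4) L

/-- A perfect matching (given as a subgraph of `P(n,2)`) has type 2 if its edge set is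
a cyclic concatenation of `C` and `D` blocks whose lengths sum to `n`. -/
def IsType2 {n : ℕ} (M : (petersen n).Subgraph) : Prop :=
  ∃ (i : ZMod n) (L : List Bool), (L.map cdLen).sum = n ∧ M.edgeSet = cdEdges n i L

section Interface

variable {n : ℕ}

theorem natCast_zmod_ne_zero (hn : 11 ≤ n) (k : ℕ) (h0 : 0 < k) (hk : k < 11) :
    (k : ZMod n) ≠ 0 := by
  rw [Ne, ZMod.natCast_eq_zero_iff]
  exact fun h => absurd (Nat.le_of_dvd h0 h) (by omega)

theorem small_ne_zero (hn : 11 ≤ n) :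
    (1 : ZMod n) ≠ 0 ∧ (2 : ZMod n) ≠ 0 ∧ (3 : ZMod n) ≠ 0 :=
  ⟨by exact_mod_cast natCast_zmod_ne_zero hn 1 (by norm_num) (by norm_num),
    by exact_mod_cast natCast_zmod_ne_zero hn 2 (by norm_num) (by norm_num),
    by exact_mod_cast natCast_zmod_ne_zero hn 3 (by norm_num) (by norm_num)⟩

/-- Exactly one of three propositions holds. -/
def ExactlyOne (a b c : Prop) : Prop :=
  (a ∧ ¬b ∧ ¬c) ∨ (¬a ∧ b ∧ ¬c) ∨ (¬a ∧ ¬b ∧ c)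

/-- The indicator functions of the edges `u_i u_{i+2}`, `v_i v_{i+1}`, `u_i v_i` of a
perfect matching of `P(n,2)`. -/
def IsConfig (x y z : ZMod n → Prop) : Prop :=
  ∀ i, ExactlyOne (x i) (x (i - 2)) (z i) ∧ ExactlyOne (y i) (y (i - 1)) (z i)

theorem petersen_adj_pu (hn : 11 ≤ n) (i : ZMod n) (w : PV n) :
    (petersen n).Adj (pu i) w ↔ w = pu (i + 2) ∨ w = pu (i - 2) ∨ w = pv i := by
  have h2 : (2 : ZMod n) ≠ 0 := by
    exact_mod_cast natCast_zmod_ne_zero hn 2 (by norm_num) (by norm_num)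
  rcases w with j | j
  · simp only [petersen, SimpleGraph.fromRel_adj, pu, pv, Sum.inl.injEq, reduceCtorEq, and_false,
      exists_false, or_false, exists_eq_left', ne_eq]
    constructor
    · rintro ⟨-, h | ⟨k, rfl, rfl⟩⟩
      · aesop
      · right; ring
    · rintro (h | h)
      · subst h; simp [h2]
      · subst h
        simp
        intro h; exact h2 (by linear_combination h)
  · simp [petersen, SimpleGraph.fromRel_adj, pu, pv, eq_comm]

theorem petersen_adj_pv (hn : 11 ≤ n) (i : ZMod n) (w : PV n) :
    (petersen n).Adj (pv i) w ↔ w = pv (i + 1) ∨ w = pv (i - 1) ∨ w = pu i := by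
  have h2 : (1 : ZMod n) ≠ 0 := by
    exact_mod_cast natCast_zmod_ne_zero hn 1 (by norm_num) (by norm_num)
  rcases w with j | j
  · simp [petersen, SimpleGraph.fromRel_adj, pu, pv, eq_comm]
  · simp only [petersen, SimpleGraph.fromRel_adj, pu, pv, Sum.inr.injEq, reduceCtorEq, and_false,
      false_and, exists_false, false_or, or_false, ne_eq]
    constructor
    · rintro ⟨-, h | ⟨k, rfl, rfl⟩⟩
      · aesop
      · right; ring
    · rintro (h | h)
      · subst h; simp [h2]
      · subst h
        simp
        intro h; exact h2 (by linear_combination h)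

theorem existsUnique_three {α : Type*} {a b c : α} (hab : a ≠ b) (hac : a ≠ c) (hbc : b ≠ c)
    {p q r : Prop} {P : α → Prop}
    (hP : ∀ w, P w ↔ (w = a ∧ p) ∨ (w = b ∧ q) ∨ (w = c ∧ r)) :
    (∃! w, P w) ↔ ExactlyOne p q r := by
  constructor
  · rintro ⟨w, hw, hu⟩
    have ha := hu a
    have hb := hu b
    have hc := hu c
    simp only [hP] at hw ha hb hc
    unfold ExactlyOne
    grind
  · rintro (⟨h1, h2, h3⟩ | ⟨h1, h2, h3⟩ | ⟨h1, h2, h3⟩)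
    · exact ⟨a, by simp [hP, h1], fun w hw => by simpa [hP, h1, h2, h3] using hw⟩
    · exact ⟨b, by simp [hP, h2], fun w hw => by simpa [hP, h1, h2, h3] using hw⟩
    · exact ⟨c, by simp [hP, h3], fun w hw => by simpa [hP, h1, h2, h3] using hw⟩

theorem pu_add_ne_pu_sub (hn : 11 ≤ n) (i : ZMod n) : (pu (i + 2) : PV n) ≠ pu (i - 2) := by
  have h4 : (4 : ZMod n) ≠ 0 := by
    exact_mod_cast natCast_zmod_ne_zero hn 4 (by norm_num) (by norm_num)
  intro h
  apply h4
  linear_combination Sum.inl.inj h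

theorem pv_add_ne_pv_sub (hn : 11 ≤ n) (i : ZMod n) : (pv (i + 1) : PV n) ≠ pv (i - 1) := by
  have h2 : (2 : ZMod n) ≠ 0 := by
    exact_mod_cast natCast_zmod_ne_zero hn 2 (by norm_num) (by norm_num)
  intro h
  apply h2
  linear_combination Sum.inr.inj h

theorem subgraph_adj_pu (hn : 11 ≤ n) (M : (petersen n).Subgraph) (i : ZMod n) (w : PV n) :
    M.Adj (pu i) w ↔ (w = pu (i + 2) ∧ M.Adj (pu i) (pu (i + 2))) ∨
      (w = pu (i - 2) ∧ M.Adj (pu (i - 2)) (pu (i - 2 + 2))) ∨ (w = pv i ∧ M.Adj (pu i) (pv i)) := by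
  rw [sub_add_cancel]
  constructor
  · intro h
    rcases (petersen_adj_pu hn i w).1 h.adj_sub with rfl | rfl | rfl
    · exact Or.inl ⟨rfl, h⟩
    · exact Or.inr (Or.inl ⟨rfl, h.symm⟩)
    · exact Or.inr (Or.inr ⟨rfl, h⟩)
  · rintro (⟨rfl, h⟩ | ⟨rfl, h⟩ | ⟨rfl, h⟩)
    exacts [h, h.symm, h]

theorem subgraph_adj_pv (hn : 11 ≤ n) (M : (petersen n).Subgraph) (i : ZMod n) (w : PV n) :
    M.Adj (pv i) w ↔ (w = pv (i + 1) ∧ M.Adj (pv i) (pv (i + 1))) ∨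
      (w = pv (i - 1) ∧ M.Adj (pv (i - 1)) (pv (i - 1 + 1))) ∨ (w = pu i ∧ M.Adj (pu i) (pv i)) := by
  rw [sub_add_cancel]
  constructor
  · intro h
    rcases (petersen_adj_pv hn i w).1 h.adj_sub with rfl | rfl | rfl
    · exact Or.inl ⟨rfl, h⟩
    · exact Or.inr (Or.inl ⟨rfl, h.symm⟩)
    · exact Or.inr (Or.inr ⟨rfl, h.symm⟩)
  · rintro (⟨rfl, h⟩ | ⟨rfl, h⟩ | ⟨rfl, h⟩)
    exacts [h, h.symm, h.symm]

theorem isPerfectMatching_iff_isConfig (hn : 11 ≤ n) (M : (petersen n).Subgraph) :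
    M.IsPerfectMatching ↔ IsConfig (fun i : ZMod n => M.Adj (pu i) (pu (i + 2)))
      (fun i => M.Adj (pv i) (pv (i + 1))) (fun i => M.Adj (pu i) (pv i)) := by
  rw [SimpleGraph.Subgraph.isPerfectMatching_iff]
  have hu : ∀ i : ZMod n, (∃! w, M.Adj (pu i) w) ↔ _ := fun i =>
    existsUnique_three (pu_add_ne_pu_sub hn i) (by simp [pu, pv]) (by simp [pu, pv])
      (subgraph_adj_pu hn M i)
  have hv : ∀ i : ZMod n, (∃! w, M.Adj (pv i) w) ↔ _ := fun i =>
    existsUnique_three (pv_add_ne_pv_sub hn i) (by simp [pu, pv]) (by simp [pu, pv])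
      (subgraph_adj_pv hn M i)
  constructor
  · exact fun h i => ⟨(hu i).1 (h _), (hv i).1 (h _)⟩
  · rintro h (i | i)
    · exact (hu i).2 (h i).1
    · exact (hv i).2 (h i).2

/-- The spanning subgraph of `P(n,2)` with prescribed edges. -/
def configSubgraph (x y z : ZMod n → Prop) : (petersen n).Subgraph where
  verts := Set.univ
  Adj a b := (petersen n).Adj a b ∧ (s(a, b) ∈ {e | ∃ i : ZMod n, (x i ∧ e = s(pu i, pu (i + 2))) ∨
    (y i ∧ e = s(pv i, pv (i + 1))) ∨ (z i ∧ e = s(pu i, pv i))})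
  adj_sub h := h.1
  edge_vert _ := Set.mem_univ _
  symm := ⟨fun a b h => ⟨h.1.symm, by rw [Sym2.eq_swap]; exact h.2⟩⟩

theorem sym2_pu_inj (hn : 11 ≤ n) {i j : ZMod n} :
    s((pu i : PV n), pu (i + 2)) = s(pu j, pu (j + 2)) ↔ i = j := by
  constructor
  · intro h
    rcases Sym2.eq_iff.1 h with ⟨h1, -⟩ | ⟨h1, h2⟩
    · exact Sum.inl.inj h1
    · have h4 := natCast_zmod_ne_zero hn 4 (by norm_num) (by norm_num)
      have h1 := Sum.inl.inj h1
      have h2 := Sum.inl.inj h2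
      exact absurd (by push_cast; linear_combination h2 - h1) h4
  · rintro rfl; rfl

theorem sym2_pv_inj (hn : 11 ≤ n) {i j : ZMod n} :
    s((pv i : PV n), pv (i + 1)) = s(pv j, pv (j + 1)) ↔ i = j := by
  constructor
  · intro h
    rcases Sym2.eq_iff.1 h with ⟨h1, -⟩ | ⟨h1, h2⟩
    · exact Sum.inr.inj h1
    · have h4 := natCast_zmod_ne_zero hn 2 (by norm_num) (by norm_num)
      have h1 := Sum.inr.inj h1
      have h2 := Sum.inr.inj h2
      exact absurd (by push_cast; linear_combination h2 - h1) h4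
  · rintro rfl; rfl

theorem configSubgraph_adj_u (hn : 11 ≤ n) (x y z : ZMod n → Prop) (i : ZMod n) :
    (configSubgraph x y z).Adj (pu i) (pu (i + 2)) ↔ x i := by
  have h : (petersen n).Adj (pu i) (pu (i + 2)) := (petersen_adj_pu hn i _).2 (Or.inl rfl)
  simp only [configSubgraph, h, true_and, Set.mem_ofPred_eq, sym2_pu_inj hn]
  simp [pu, pv]

theorem configSubgraph_adj_v (hn : 11 ≤ n) (x y z : ZMod n → Prop) (i : ZMod n) :
    (configSubgraph x y z).Adj (pv i) (pv (i + 1)) ↔ y i := by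
  have h : (petersen n).Adj (pv i) (pv (i + 1)) := (petersen_adj_pv hn i _).2 (Or.inl rfl)
  simp only [configSubgraph, h, true_and, Set.mem_ofPred_eq, sym2_pv_inj hn]
  simp [pu, pv]

theorem configSubgraph_adj_z (hn : 11 ≤ n) (x y z : ZMod n → Prop) (i : ZMod n) :
    (configSubgraph x y z).Adj (pu i) (pv i) ↔ z i := by
  have h : (petersen n).Adj (pu i) (pv i) := (petersen_adj_pu hn i _).2 (Or.inr (Or.inr rfl))
  simp only [configSubgraph, h, true_and, Set.mem_ofPred_eq]
  simp [pu, pv]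

theorem configSubgraph_isPerfectMatching (hn : 11 ≤ n) {x y z : ZMod n → Prop}
    (h : IsConfig x y z) : (configSubgraph x y z).IsPerfectMatching := by
  rw [isPerfectMatching_iff_isConfig hn]
  simpa only [configSubgraph_adj_u hn, configSubgraph_adj_v hn, configSubgraph_adj_z hn] using h

theorem petersen_edge_cases (hn : 11 ≤ n) {e : Sym2 (PV n)} (he : e ∈ (petersen n).edgeSet) :
    ∃ i : ZMod n, e = s(pu i, pu (i + 2)) ∨ e = s(pv i, pv (i + 1)) ∨ e = s(pu i, pv i) := by
  induction e using Sym2.ind with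
  | _ a b =>
    rw [SimpleGraph.mem_edgeSet] at he
    rcases a with i | i
    · rcases (petersen_adj_pu hn i b).1 he with rfl | rfl | rfl
      · exact ⟨i, Or.inl rfl⟩
      · exact ⟨i - 2, Or.inl (by rw [sub_add_cancel, Sym2.eq_swap]; rfl)⟩
      · exact ⟨i, Or.inr (Or.inr rfl)⟩
    · rcases (petersen_adj_pv hn i b).1 he with rfl | rfl | rfl
      · exact ⟨i, Or.inr (Or.inl rfl)⟩
      · exact ⟨i - 1, Or.inr (Or.inl (by rw [sub_add_cancel, Sym2.eq_swap]; rfl))⟩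
      · exact ⟨i, Or.inr (Or.inr (by rw [Sym2.eq_swap]; rfl))⟩

theorem IsPerfectMatching.eq_of_edgeSet_subset {V : Type*} {G : SimpleGraph V}
    {M M' : G.Subgraph} (hM : M.IsPerfectMatching) (hM' : M'.IsPerfectMatching)
    (h : M.edgeSet ⊆ M'.edgeSet) : M' = M := by
  rw [SimpleGraph.Subgraph.isPerfectMatching_iff] at hM hM'
  have hadj : ∀ a b, M.Adj a b → M'.Adj a b := fun a b hab => h (a := s(a, b)) hab
  ext a b
  · exact ⟨fun _ => (hM a).exists.elim fun _ hw => hw.fst_mem,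
      fun _ => (hM' a).exists.elim fun _ hw => hw.fst_mem⟩
  · refine ⟨fun hab => ?_, hadj a b⟩
    obtain ⟨c, hc⟩ := (hM a).exists
    rwa [(hM' a).unique hab (hadj a c hc)]

theorem forcingNumber_spec {V : Type*} {G : SimpleGraph V} {M : G.Subgraph}
    (hM : M.IsPerfectMatching) : ∃ S, IsForcingSet G M S ∧ S.ncard = forcingNumber G M :=
  Nat.sInf_mem (s := {k | ∃ S : Set (Sym2 V), IsForcingSet G M S ∧ S.ncard = k})
    ⟨_, M.edgeSet, ⟨subset_rfl, fun _ hM' h =>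
      IsPerfectMatching.eq_of_edgeSet_subset hM hM' h⟩, rfl⟩

end Interface

section LowerBound

variable {n : ℕ} {t X Y Z : ZMod n → Prop}

/-- `t` is the set of starting positions of the `A` blocks of a type-1 matching which contains
the marked edges `X` (outer), `Y` (inner) and `Z` (spokes). -/
structure IsBlockStart (t X Y Z : ZMod n → Prop) : Prop where
  spaced : ∀ i, t i → ¬t (i + 1) ∧ ¬t (i + 2) ∧ ¬t (i + 3)
  outer : ∀ i, X i → t i ∨ t (i - 1)
  inner : ∀ i, Y i → t i ∨ t (i - 2)
  spoke : ∀ i, Z i → ¬t i ∧ ¬t (i - 1) ∧ ¬t (i - 2) ∧ ¬t (i - 3)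

/-- Position `i` is an unmarked spoke. -/
def IsFree (t Z : ZMod n → Prop) (i : ZMod n) : Prop :=
  ¬Z i ∧ ¬t i ∧ ¬t (i - 1) ∧ ¬t (i - 2) ∧ ¬t (i - 3)

theorem IsBlockStart.exists_mark (h : IsBlockStart t X Y Z)
    (hf : ∀ t', IsBlockStart t' X Y Z → t' = t) {i : ZMod n} (hi : t i) :
    X i ∨ X (i + 1) ∨ Y i ∨ Y (i + 2) := by
  by_contra hc
  have : IsBlockStart (fun j => t j ∧ j ≠ i) X Y Z := by
    refine ⟨fun j hj => ?_, fun j hj => ?_, fun j hj => ?_, fun j hj => ?_⟩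
    · have := h.spaced j hj.1; tauto
    · have := h.outer j hj; grind
    · have := h.inner j hj; grind
    · have := h.spoke j hj; tauto
  have := congrFun (hf _ this) i
  simp [hi] at this

theorem IsBlockStart.not_four_free (hn : 11 ≤ n) (h : IsBlockStart t X Y Z)
    (hf : ∀ t', IsBlockStart t' X Y Z → t' = t) (i : ZMod n) (h0 : IsFree t Z i)
    (h1 : IsFree t Z (i + 1)) (h2 : IsFree t Z (i + 2)) : ¬IsFree t Z (i + 3) := by
  intro h3
  obtain ⟨e1, e2, e3⟩ := small_ne_zero hn
  unfold IsFree at *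
  have : IsBlockStart (fun j => t j ∨ j = i) X Y Z := by
    refine ⟨fun j hj => ?_, fun j hj => ?_, fun j hj => ?_, fun j hj => ?_⟩
    · have := h.spaced j; grind
    · have := h.outer j hj; tauto
    · have := h.inner j hj; tauto
    · have := h.spoke j hj; grind
  have := congrFun (hf _ this) i
  simp [h0] at this

theorem IsBlockStart.not_free_of_outer_right (hn : 11 ≤ n) (h : IsBlockStart t X Y Z)
    (hf : ∀ t', IsBlockStart t' X Y Z → t' = t) {i : ZMod n} (hi : t i)
    (h0 : ¬X i) (h1 : ¬Y i) (h2 : ¬Y (i + 2)) : ¬IsFree t Z (i + 4) := by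
  intro h3
  obtain ⟨e1, e2, e3⟩ := small_ne_zero hn
  unfold IsFree at *
  have hs := h.spaced i hi
  have : IsBlockStart (fun j => (t j ∧ j ≠ i) ∨ j = i + 1) X Y Z := by
    refine ⟨fun j hj => ?_, fun j hj => ?_, fun j hj => ?_, fun j hj => ?_⟩
    · have := h.spaced j
      grind
    · have := h.outer j hj; grind
    · have := h.inner j hj; grind
    · have := h.spoke j hj; grind
  have := congrFun (hf _ this) i
  simp [hi] at this
  grind

theorem IsBlockStart.not_free_of_inner_right (hn : 11 ≤ n) (h : IsBlockStart t X Y Z)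
    (hf : ∀ t', IsBlockStart t' X Y Z → t' = t) {i : ZMod n} (hi : t i)
    (h0 : ¬X i) (h1 : ¬Y i) (h2 : ¬X (i + 1)) : ¬(IsFree t Z (i + 4) ∧ IsFree t Z (i + 5)) := by
  intro h3
  obtain ⟨e1, e2, e3⟩ := small_ne_zero hn
  unfold IsFree at *
  have hs := h.spaced i hi
  have : IsBlockStart (fun j => (t j ∧ j ≠ i) ∨ j = i + 2) X Y Z := by
    refine ⟨fun j hj => ?_, fun j hj => ?_, fun j hj => ?_, fun j hj => ?_⟩
    · have := h.spaced j
      grind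
    · have := h.outer j hj; grind
    · have := h.inner j hj; grind
    · have := h.spoke j hj; grind
  have := congrFun (hf _ this) i
  simp [hi] at this
  grind

theorem IsBlockStart.not_free_of_outer_left (hn : 11 ≤ n) (h : IsBlockStart t X Y Z)
    (hf : ∀ t', IsBlockStart t' X Y Z → t' = t) {i : ZMod n} (hi : t i)
    (h0 : ¬X (i + 1)) (h1 : ¬Y i) (h2 : ¬Y (i + 2)) : ¬IsFree t Z (i - 1) := by
  intro h3
  obtain ⟨e1, e2, e3⟩ := small_ne_zero hn
  unfold IsFree at *
  have hs := h.spaced i hi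
  have : IsBlockStart (fun j => (t j ∧ j ≠ i) ∨ j = i - 1) X Y Z := by
    refine ⟨fun j hj => ?_, fun j hj => ?_, fun j hj => ?_, fun j hj => ?_⟩
    · have := h.spaced j
      grind
    · have := h.outer j hj; grind
    · have := h.inner j hj; grind
    · have := h.spoke j hj; grind
  have := congrFun (hf _ this) i
  simp [hi] at this
  grind

theorem IsBlockStart.not_free_of_inner_left (hn : 11 ≤ n) (h : IsBlockStart t X Y Z)
    (hf : ∀ t', IsBlockStart t' X Y Z → t' = t) {i : ZMod n} (hi : t i)
    (h0 : ¬X i) (h1 : ¬X (i + 1)) (h2 : ¬Y (i + 2)) :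
    ¬(IsFree t Z (i - 1) ∧ IsFree t Z (i - 2)) := by
  intro h3
  obtain ⟨e1, e2, e3⟩ := small_ne_zero hn
  unfold IsFree at *
  have hs := h.spaced i hi
  have : IsBlockStart (fun j => (t j ∧ j ≠ i) ∨ j = i - 2) X Y Z := by
    refine ⟨fun j hj => ?_, fun j hj => ?_, fun j hj => ?_, fun j hj => ?_⟩
    · have := h.spaced j
      grind
    · have := h.outer j hj; grind
    · have := h.inner j hj; grind
    · have := h.spoke j hj; grind
  have := congrFun (hf _ this) i
  simp [hi] at this
  grind

/-- The block starting at `i` carries at most one of the marks `u_{i+1} u_{i+3}` and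
`v_{i+2} v_{i+3}`, and no other. -/
def IsRight (t X Y : ZMod n → Prop) (i : ZMod n) : Prop :=
  t i ∧ ¬X i ∧ ¬Y i ∧ ¬(X (i + 1) ∧ Y (i + 2))

open Classical in
/-- The integer indicator of a proposition. -/
noncomputable def ind (p : Prop) : ℤ := if p then 1 else 0

/-- Six times the number of marks charged to column `i`, minus the number of columns charged
to it: a block is charged to its first column. -/
noncomputable def weight (t X Y Z : ZMod n → Prop) (i : ZMod n) : ℤ :=
  6 * (ind (t i ∧ X i) + ind (t i ∧ X (i + 1)) + ind (t i ∧ Y i) + ind (t i ∧ Y (i + 2))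
    + ind (Z i)) - ind (IsFree t Z i) - ind (Z i) - 4 * ind (t i)

open Classical in
/-- `0` in the blocks whose only mark is `u_{i+1} u_{i+3}` or `v_{i+2} v_{i+3}`, and `1` in all other
blocks. -/
noncomputable def rho (t X Y : ZMod n → Prop) (i : ZMod n) : ℤ :=
  if IsRight t X Y i ∨ IsRight t X Y (i - 1) ∨ IsRight t X Y (i - 2) ∨ IsRight t X Y (i - 3)
  then 0 else 1

open Classical in
/-- The potential after position `i`: the value of `rho` at the last position that is not an unmarked
spoke, minus the number of unmarked spokes after it. -/
noncomputable def phi (t X Y Z : ZMod n → Prop) (i : ZMod n) : ℤ :=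
  if ¬IsFree t Z i then rho t X Y i
  else if ¬IsFree t Z (i - 1) then rho t X Y (i - 1) - 1
  else if ¬IsFree t Z (i - 2) then rho t X Y (i - 2) - 2
  else rho t X Y (i - 3) - 3

/-- The weight of column `i` corrected by the change of potential. -/
noncomputable def slack (t X Y Z : ZMod n → Prop) (i : ZMod n) : ℤ :=
  weight t X Y Z i + phi t X Y Z (i - 1) - phi t X Y Z i

theorem sum_slack [NeZero n] (h : IsBlockStart t X Y Z) :
    ∑ i, slack t X Y Z i = 6 * ∑ i, (ind (X i) + ind (Y i) + ind (Z i)) - n := by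
  have shift : ∀ (f : ZMod n → ℤ) (c : ZMod n), ∑ i, f (i - c) = ∑ i, f i := fun f c =>
    Equiv.sum_comp (Equiv.subRight c) f
  have hcol : ∀ i, ind (IsFree t Z i) + ind (Z i) + ind (t i) + ind (t (i - 1)) + ind (t (i - 2))
      + ind (t (i - 3)) = 1 := by
    intro i
    have h1 := h.spaced (i - 1)
    have h2 := h.spaced (i - 2)
    have h3 := h.spaced (i - 3)
    have h4 := h.spoke i
    rw [show i - 1 + 1 = i by ring] at h1
    rw [show i - 2 + 1 = i - 1 by ring, show i - 2 + 2 = i by ring] at h2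
    rw [show i - 3 + 1 = i - 2 by ring, show i - 3 + 2 = i - 1 by ring,
      show i - 3 + 3 = i by ring] at h3
    unfold ind IsFree
    by_cases a0 : t i <;> by_cases a1 : t (i - 1) <;> by_cases a2 : t (i - 2) <;>
      by_cases a3 : t (i - 3) <;> by_cases a4 : Z i <;> simp_all
  have hX : ∀ i, ind (X i) = ind (t i ∧ X i) + ind (t (i - 1) ∧ X i) := by
    intro i
    have h1 := h.spaced (i - 1)
    have h2 := h.outer i
    rw [show i - 1 + 1 = i by ring] at h1
    unfold ind
    by_cases a0 : t i <;> by_cases a1 : t (i - 1) <;> by_cases a2 : X i <;> simp_all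
  have hY : ∀ i, ind (Y i) = ind (t i ∧ Y i) + ind (t (i - 2) ∧ Y i) := by
    intro i
    have h1 := h.spaced (i - 2)
    have h2 := h.inner i
    rw [show i - 2 + 2 = i by ring] at h1
    unfold ind
    by_cases a0 : t i <;> by_cases a1 : t (i - 2) <;> by_cases a2 : Y i <;> simp_all
  have hn' : (n : ℤ) = ∑ i : ZMod n, 1 := by simp [ZMod.card]
  rw [hn', ← Finset.sum_congr rfl (fun i _ => hcol i)]
  simp only [slack, weight, Finset.sum_congr rfl (fun i _ => hX i),
    Finset.sum_congr rfl (fun i _ => hY i), Finset.sum_add_distrib, Finset.sum_sub_distrib,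
    ← Finset.mul_sum]
  have sX := shift (fun i => ind (t i ∧ X (i + 1))) 1
  have sY := shift (fun i => ind (t i ∧ Y (i + 2))) 2
  have s1 := shift (fun i => ind (t i)) 1
  have s2 := shift (fun i => ind (t i)) 2
  have s3 := shift (fun i => ind (t i)) 3
  have sp := shift (phi t X Y Z) 1
  simp only [sub_add_cancel] at sX sY
  rw [sX, sY, s1, s2, s3, sp]
  ring

theorem phi_cases (hn : 11 ≤ n) (h : IsBlockStart t X Y Z)
    (hf : ∀ t', IsBlockStart t' X Y Z → t' = t) (i : ZMod n) :
    (¬IsFree t Z i ∧ phi t X Y Z i = rho t X Y i) ∨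
    (IsFree t Z i ∧ ¬IsFree t Z (i - 1) ∧ phi t X Y Z i = rho t X Y (i - 1) - 1) ∨
    (IsFree t Z i ∧ IsFree t Z (i - 1) ∧ ¬IsFree t Z (i - 2) ∧ rho t X Y (i - 2) = 1 ∧
      phi t X Y Z i = -1) ∨
    (IsFree t Z i ∧ IsFree t Z (i - 1) ∧ IsFree t Z (i - 2) ∧ ¬IsFree t Z (i - 3) ∧
      rho t X Y (i - 3) = 1 ∧ phi t X Y Z i = -2) := by
  have key : ∀ j, IsFree t Z (j + 1) → IsFree t Z (j + 2) → rho t X Y j = 1 := by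
    intro j h1 h2
    unfold rho
    rw [if_neg]
    have h1' := h1
    unfold IsFree at h1'
    rw [show j + 1 - 1 = j by ring, show j + 1 - 2 = j - 1 by ring,
      show j + 1 - 3 = j - 2 by ring] at h1'
    rintro (hR | hR | hR | hR)
    · exact h1'.2.2.1 hR.1
    · exact h1'.2.2.2.1 hR.1
    · exact h1'.2.2.2.2 hR.1
    · have hm := h.exists_mark hf hR.1
      have := h.not_free_of_outer_right hn hf hR.1 hR.2.1 hR.2.2.1
      have := h.not_free_of_inner_right hn hf hR.1 hR.2.1 hR.2.2.1
      rw [show j - 3 + 4 = j + 1 by ring] at *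
      rw [show j - 3 + 5 = j + 2 by ring] at *
      have := hR.2
      tauto
  have h4 := h.not_four_free hn hf (i - 3)
  have k2 := key (i - 2)
  have k3 := key (i - 3)
  rw [show i - 3 + 1 = i - 2 by ring, show i - 3 + 2 = i - 1 by ring] at *
  rw [show i - 3 + 3 = i by ring] at *
  rw [show i - 2 + 1 = i - 1 by ring, show i - 2 + 2 = i by ring] at *
  unfold phi
  by_cases a0 : IsFree t Z i <;> by_cases a1 : IsFree t Z (i - 1) <;>
    by_cases a2 : IsFree t Z (i - 2) <;> by_cases a3 : IsFree t Z (i - 3) <;> simp_all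

/-- The block starting at `i` carries exactly one of the marks `u_i u_{i+2}` and `v_i v_{i+1}`,
and no other. -/
def IsLeft (t X Y : ZMod n → Prop) (i : ZMod n) : Prop :=
  t i ∧ ¬X (i + 1) ∧ ¬Y (i + 2) ∧ ¬(X i ∧ Y i)

theorem rho_nonneg (i : ZMod n) : 0 ≤ rho t X Y i := by unfold rho; split_ifs <;> norm_num

theorem rho_le_one (i : ZMod n) : rho t X Y i ≤ 1 := by unfold rho; split_ifs <;> norm_num

theorem neg_two_le_phi (hn : 11 ≤ n) (h : IsBlockStart t X Y Z)
    (hf : ∀ t', IsBlockStart t' X Y Z → t' = t) (i : ZMod n) : -2 ≤ phi t X Y Z i := by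
  have h0 := rho_nonneg (t := t) (X := X) (Y := Y) i
  have h1 := rho_nonneg (t := t) (X := X) (Y := Y) (i - 1)
  rcases phi_cases hn h hf i with H | H | H | H <;> omega

theorem slack_eq_zero (hn : 11 ≤ n) (h : IsBlockStart t X Y Z)
    (hf : ∀ t', IsBlockStart t' X Y Z → t' = t) {i : ZMod n} (hi : ¬t i) (hz : ¬Z i) :
    slack t X Y Z i = 0 := by
  by_cases hF : IsFree t Z i
  · have h4 := h.not_four_free hn hf (i - 3)
    rw [show i - 3 + 1 = i - 2 by ring, show i - 3 + 2 = i - 1 by ring,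
      show i - 3 + 3 = i by ring] at h4
    have hw : weight t X Y Z i = -1 := by simp [weight, ind, hi, hz, hF]
    have c0 := phi_cases hn h hf i
    have c1 := phi_cases hn h hf (i - 1)
    rw [show i - 1 - 1 = i - 2 by ring, show i - 1 - 2 = i - 3 by ring] at c1
    unfold slack
    rcases c0 with H | H | H | H <;> rcases c1 with H' | H' | H' | H' <;>
      first | omega | simp_all
  · have hw : weight t X Y Z i = 0 := by simp [weight, ind, hi, hz, hF]
    have hint : t (i - 1) ∨ t (i - 2) ∨ t (i - 3) := by unfold IsFree at hF; tauto
    have s1 := h.spaced (i - 1)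
    have s2 := h.spaced (i - 2)
    have s3 := h.spaced (i - 3)
    have s4 := h.spaced (i - 4)
    rw [show i - 1 + 1 = i by ring] at s1
    rw [show i - 2 + 1 = i - 1 by ring, show i - 2 + 2 = i by ring] at s2
    rw [show i - 3 + 1 = i - 2 by ring, show i - 3 + 2 = i - 1 by ring,
      show i - 3 + 3 = i by ring] at s3
    rw [show i - 4 + 1 = i - 3 by ring, show i - 4 + 2 = i - 2 by ring,
      show i - 4 + 3 = i - 1 by ring] at s4
    have hF1 : ¬IsFree t Z (i - 1) := by
      unfold IsFree
      rw [show i - 1 - 1 = i - 2 by ring, show i - 1 - 2 = i - 3 by ring]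
      tauto
    have r0 : ¬IsRight t X Y i := fun H => hi H.1
    have r4 : ¬IsRight t X Y (i - 4) := fun H => by
      have := s4 H.1
      tauto
    have hr : rho t X Y i = rho t X Y (i - 1) := by
      classical
      unfold rho
      refine if_congr ?_ rfl rfl
      rw [show i - 1 - 1 = i - 2 by ring, show i - 1 - 2 = i - 3 by ring,
        show i - 1 - 3 = i - 4 by ring]
      simp only [r0, r4, false_or, or_false]
    simp [slack, hw, phi, hF, hF1, hr]

theorem two_le_slack_of_spoke (hn : 11 ≤ n) (h : IsBlockStart t X Y Z)
    (hf : ∀ t', IsBlockStart t' X Y Z → t' = t) {i : ZMod n} (hz : Z i) :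
    2 ≤ slack t X Y Z i := by
  have hi := (h.spoke i hz).1
  have hF : ¬IsFree t Z i := fun H => H.1 hz
  have hw : weight t X Y Z i = 5 := by simp [weight, ind, hi, hz, hF]
  have h1 := neg_two_le_phi hn h hf (i - 1)
  have h2 := rho_le_one (t := t) (X := X) (Y := Y) i
  have h3 : phi t X Y Z i = rho t X Y i := by simp [phi, hF]
  unfold slack
  omega

theorem slack_start_cases (hn : 11 ≤ n) (h : IsBlockStart t X Y Z)
    (hf : ∀ t', IsBlockStart t' X Y Z → t' = t) {i : ZMod n} (hi : t i) :
    (IsRight t X Y i ∧ slack t X Y Z i = 2 + phi t X Y Z (i - 1)) ∨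
    (IsLeft t X Y i ∧ slack t X Y Z i = 1 + phi t X Y Z (i - 1) ∧ -1 ≤ phi t X Y Z (i - 1)) ∨
    2 ≤ slack t X Y Z i := by
  have hF : ¬IsFree t Z i := fun H => H.2.1 hi
  have hz : ¬Z i := fun H => (h.spoke i H).1 hi
  have hm := h.exists_mark hf hi
  have h1 := neg_two_le_phi hn h hf (i - 1)
  have h3 : phi t X Y Z i = rho t X Y i := by simp [phi, hF]
  have h2 := rho_le_one (t := t) (X := X) (Y := Y) i
  by_cases hR : IsRight t X Y i
  · left
    refine ⟨hR, ?_⟩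
    have hr : rho t X Y i = 0 := by simp [rho, hR]
    have hw : weight t X Y Z i = 2 := by
      obtain ⟨_, r1, r2, r3⟩ := hR
      by_cases a1 : X (i + 1) <;> by_cases a2 : Y (i + 2) <;>
        simp_all [weight, ind]
    rw [slack, h3, hr, hw]
    ring
  right
  have hr : rho t X Y i = 1 := by
    have s1 := h.spaced (i - 1)
    have s2 := h.spaced (i - 2)
    have s3 := h.spaced (i - 3)
    rw [show i - 1 + 1 = i by ring] at s1
    rw [show i - 2 + 2 = i by ring] at s2
    rw [show i - 3 + 3 = i by ring] at s3
    have r1 : ¬IsRight t X Y (i - 1) := fun H => (s1 H.1).1 hi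
    have r2 : ¬IsRight t X Y (i - 2) := fun H => (s2 H.1).2.1 hi
    have r3 : ¬IsRight t X Y (i - 3) := fun H => (s3 H.1).2.2 hi
    simp [rho, hR, r1, r2, r3]
  by_cases hL : IsLeft t X Y i
  · left
    have hw : weight t X Y Z i = 2 := by
      obtain ⟨_, r1, r2, r3⟩ := hL
      by_cases a1 : X i <;> by_cases a2 : Y i <;> simp_all [weight, ind]
    refine ⟨hL, by rw [slack, h3, hr, hw]; ring, ?_⟩
    by_contra hc
    have h4 := rho_nonneg (t := t) (X := X) (Y := Y) (i - 1)
    have h5 := rho_nonneg (t := t) (X := X) (Y := Y) (i - 1 - 1)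
    obtain ⟨_, r1, r2, r3⟩ := hL
    have := h.not_free_of_outer_left hn hf hi r1
    have := h.not_free_of_inner_left hn hf hi
    rw [show i - 2 = i - 1 - 1 by ring] at this
    rcases phi_cases hn h hf (i - 1) with H | H | H | H
    · omega
    · omega
    all_goals
      have h6 := H.1
      have h7 := H.2.1
      tauto
  · right
    have hw : 8 ≤ weight t X Y Z i := by
      unfold IsRight IsLeft at *
      by_cases a1 : X i <;> by_cases a2 : Y i <;> by_cases a3 : X (i + 1) <;>
        by_cases a4 : Y (i + 2) <;> simp_all [weight, ind]
    unfold slack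
    omega

theorem IsRight.inner_mark (hn : 11 ≤ n) (h : IsBlockStart t X Y Z)
    (hf : ∀ t', IsBlockStart t' X Y Z → t' = t) {i : ZMod n} (hi : IsRight t X Y i)
    (hF : IsFree t Z (i + 4)) : Y (i + 2) ∧ ¬X (i + 1) := by
  have := h.not_free_of_outer_right hn hf hi.1 hi.2.1 hi.2.2.1
  have := hi.2.2.2
  tauto

theorem IsLeft.inner_mark (hn : 11 ≤ n) (h : IsBlockStart t X Y Z)
    (hf : ∀ t', IsBlockStart t' X Y Z → t' = t) {i : ZMod n} (hi : IsLeft t X Y i)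
    (hF : IsFree t Z (i - 1)) : Y i ∧ ¬X i := by
  have := h.not_free_of_outer_left hn hf hi.1 hi.2.1
  have := hi.2.2
  tauto

theorem IsRight.not_isLeft (h : IsBlockStart t X Y Z)
    (hf : ∀ t', IsBlockStart t' X Y Z → t' = t) {i : ZMod n} (hR : IsRight t X Y i) :
    ¬IsLeft t X Y i := fun hL => by
  rcases h.exists_mark hf hR.1 with H | H | H | H
  exacts [hR.2.1 H, hL.2.1 H, hR.2.2.1 H, hL.2.2.1 H]

/-- The block preceding the one starting at `i`, in terms of the potential just before `i`. -/
theorem previous_block (hn : 11 ≤ n) (h : IsBlockStart t X Y Z)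
    (hf : ∀ t', IsBlockStart t' X Y Z → t' = t) (hz : ∀ i, ¬Z i)
    (hRL : ∀ i, t i → IsRight t X Y i ∨ IsLeft t X Y i) {i : ZMod n} (hi : t i) :
    (IsRight t X Y (i - 4) ∧ phi t X Y Z (i - 1) = 0) ∨
    (IsLeft t X Y (i - 4) ∧ phi t X Y Z (i - 1) = 1) ∨
    (IsRight t X Y (i - 5) ∧ IsFree t Z (i - 1) ∧ phi t X Y Z (i - 1) = -1) ∨
    (IsLeft t X Y (i - 5) ∧ IsFree t Z (i - 1) ∧ phi t X Y Z (i - 1) = 0) ∨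
    (IsLeft t X Y (i - 6) ∧ IsFree t Z (i - 1) ∧ IsFree t Z (i - 2) ∧
      phi t X Y Z (i - 1) = -1) ∨
    (IsLeft t X Y (i - 7) ∧ IsFree t Z (i - 1) ∧ IsFree t Z (i - 2) ∧
      phi t X Y Z (i - 1) = -2) := by
  have key : ∀ j, ¬IsFree t Z j → (t (j + 1) ∨ IsFree t Z (j + 1)) →
      (IsRight t X Y (j - 3) ∧ rho t X Y j = 0) ∨ (IsLeft t X Y (j - 3) ∧ rho t X Y j = 1) := by
    intro j h1 h2
    have s1 := h.spaced j
    have s2 := h.spaced (j - 1)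
    have s3 := h.spaced (j - 2)
    rw [show j - 1 + 2 = j + 1 by ring] at s2
    rw [show j - 2 + 3 = j + 1 by ring] at s3
    have a0 : ¬t j ∧ ¬t (j - 1) ∧ ¬t (j - 2) := by
      unfold IsFree at h2
      rw [show j + 1 - 1 = j by ring, show j + 1 - 2 = j - 1 by ring,
        show j + 1 - 3 = j - 2 by ring] at h2
      tauto
    have a3 : t (j - 3) := by
      have := hz j
      unfold IsFree at h1
      tauto
    have r0 : ¬IsRight t X Y j := fun H => a0.1 H.1
    have r1 : ¬IsRight t X Y (j - 1) := fun H => a0.2.1 H.1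
    have r2 : ¬IsRight t X Y (j - 2) := fun H => a0.2.2 H.1
    by_cases r3 : IsRight t X Y (j - 3)
    · exact Or.inl ⟨r3, by simp [rho, r3]⟩
    · exact Or.inr ⟨(hRL _ a3).resolve_left r3, by simp [rho, r0, r1, r2, r3]⟩
  have k1 := key (i - 1)
  have k2 := key (i - 2)
  have k3 := key (i - 3)
  have k4 := key (i - 4)
  have c := phi_cases hn h hf (i - 1)
  rw [show i - 1 - 1 = i - 2 by ring, show i - 1 - 2 = i - 3 by ring,
    show i - 1 - 3 = i - 4 by ring] at c
  rw [show i - 1 + 1 = i by ring, show i - 1 - 3 = i - 4 by ring] at k1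
  rw [show i - 2 + 1 = i - 1 by ring, show i - 2 - 3 = i - 5 by ring] at k2
  rw [show i - 3 + 1 = i - 2 by ring, show i - 3 - 3 = i - 6 by ring] at k3
  rw [show i - 4 + 1 = i - 3 by ring, show i - 4 - 3 = i - 7 by ring] at k4
  rcases c with ⟨c1, c2⟩ | ⟨c1, c2, c3⟩ | ⟨c1, c2, c3, c4, c5⟩ | ⟨c1, c2, c3, c4, c5, c6⟩
  · rcases k1 c1 (Or.inl hi) with ⟨a, b⟩ | ⟨a, b⟩
    · exact Or.inl ⟨a, by omega⟩
    · exact Or.inr (Or.inl ⟨a, by omega⟩)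
  · rcases k2 c2 (Or.inr c1) with ⟨a, b⟩ | ⟨a, b⟩
    · exact Or.inr (Or.inr (Or.inl ⟨a, c1, by omega⟩))
    · exact Or.inr (Or.inr (Or.inr (Or.inl ⟨a, c1, by omega⟩)))
  · rcases k3 c3 (Or.inr c2) with ⟨a, b⟩ | ⟨a, b⟩
    · omega
    · exact Or.inr (Or.inr (Or.inr (Or.inr (Or.inl ⟨a, c1, c2, c5⟩))))
  · rcases k4 c4 (Or.inr c3) with ⟨a, b⟩ | ⟨a, b⟩
    · omega
    · exact Or.inr (Or.inr (Or.inr (Or.inr (Or.inr ⟨a, c1, c2, c6⟩))))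

/-- The block starts at which the slack is at most one. -/
theorem start_cases (hn : 11 ≤ n) (h : IsBlockStart t X Y Z)
    (hf : ∀ t', IsBlockStart t' X Y Z → t' = t) (hz : ∀ i, ¬Z i)
    (hs : ∀ i, slack t X Y Z i ≤ 1) {i : ZMod n} (hi : t i) :
    (IsRight t X Y i ∧ IsLeft t X Y (i - 7) ∧ IsFree t Z (i - 1) ∧ slack t X Y Z i = 0) ∨
    (IsLeft t X Y i ∧ IsRight t X Y (i - 5) ∧ IsFree t Z (i - 1) ∧ slack t X Y Z i = 0) ∨
    (slack t X Y Z i = 1 ∧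
      (IsRight t X Y i ∧ (IsLeft t X Y (i - 6) ∨ IsRight t X Y (i - 5)) ∨
       IsLeft t X Y i ∧ (IsRight t X Y (i - 4) ∨ IsLeft t X Y (i - 5)))) := by
  have hRL : ∀ i, t i → IsRight t X Y i ∨ IsLeft t X Y i := by
    intro j hj
    have := hs j
    rcases slack_start_cases hn h hf hj with H | H | H
    · exact Or.inl H.1
    · exact Or.inr H.1
    · omega
  have hc := previous_block hn h hf hz hRL hi
  have hsi := hs i
  rcases slack_start_cases hn h hf hi with ⟨H1, H2⟩ | ⟨H1, H2, H3⟩ | H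
  · rcases hc with c | c | c | c | c | c
    · omega
    · omega
    · exact Or.inr (Or.inr ⟨by omega, Or.inl ⟨H1, Or.inr c.1⟩⟩)
    · omega
    · exact Or.inr (Or.inr ⟨by omega, Or.inl ⟨H1, Or.inl c.1⟩⟩)
    · exact Or.inl ⟨H1, c.1, c.2.1, by omega⟩
  · rcases hc with c | c | c | c | c | c
    · exact Or.inr (Or.inr ⟨by omega, Or.inr ⟨H1, Or.inl c.1⟩⟩)
    · omega
    · exact Or.inr (Or.inl ⟨H1, c.1, c.2.1, by omega⟩)
    · exact Or.inr (Or.inr ⟨by omega, Or.inr ⟨H1, Or.inr c.1⟩⟩)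
    · exfalso
      have m := H1.inner_mark hn h hf c.2.1
      exact h.not_free_of_inner_left hn hf hi m.2 H1.2.1 H1.2.2.1 ⟨c.2.1, c.2.2.1⟩
    · omega
  · omega

theorem IsBlockStart.exists_next (hn : 11 ≤ n) (h : IsBlockStart t X Y Z)
    (hf : ∀ t', IsBlockStart t' X Y Z → t' = t) (hz : ∀ i, ¬Z i) {i : ZMod n} (hi : t i) :
    ∃ d : ℕ, 4 ≤ d ∧ d ≤ 7 ∧ t (i + d) ∧ ∀ c : ℕ, 0 < c → c < d → ¬t (i + c) := by
  have s := h.spaced i hi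
  have hF := h.not_four_free hn hf (i + 4)
  rw [show i + 4 + 1 = i + 5 by ring, show i + 4 + 2 = i + 6 by ring,
    show i + 4 + 3 = i + 7 by ring] at hF
  unfold IsFree at hF
  rw [show i + 4 - 1 = i + 3 by ring, show i + 4 - 2 = i + 2 by ring,
    show i + 4 - 3 = i + 1 by ring, show i + 5 - 1 = i + 4 by ring,
    show i + 5 - 2 = i + 3 by ring,
    show i + 5 - 3 = i + 2 by ring, show i + 6 - 1 = i + 5 by ring,
    show i + 6 - 2 = i + 4 by ring,
    show i + 6 - 3 = i + 3 by ring, show i + 7 - 1 = i + 6 by ring,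
    show i + 7 - 2 = i + 5 by ring,
    show i + 7 - 3 = i + 4 by ring] at hF
  have z4 := hz (i + 4)
  have z5 := hz (i + 5)
  have z6 := hz (i + 6)
  have z7 := hz (i + 7)
  by_cases a4 : t (i + 4)
  · refine ⟨4, by norm_num, by norm_num, by exact_mod_cast a4, fun c h0 h1 => ?_⟩
    interval_cases c <;> push_cast <;> tauto
  by_cases a5 : t (i + 5)
  · refine ⟨5, by norm_num, by norm_num, by exact_mod_cast a5, fun c h0 h1 => ?_⟩
    interval_cases c <;> push_cast <;> tauto
  by_cases a6 : t (i + 6)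
  · refine ⟨6, by norm_num, by norm_num, by exact_mod_cast a6, fun c h0 h1 => ?_⟩
    interval_cases c <;> push_cast <;> tauto
  refine ⟨7, by norm_num, by norm_num, by push_cast; tauto, fun c h0 h1 => ?_⟩
  interval_cases c <;> push_cast <;> tauto

/-- The block following the one starting at `i` determines the side of the mark of the latter,
provided that it has no slack. -/
theorem next_block (hn : 11 ≤ n) (h : IsBlockStart t X Y Z)
    (hf : ∀ t', IsBlockStart t' X Y Z → t' = t) (hz : ∀ i, ¬Z i)
    (hs : ∀ i, slack t X Y Z i ≤ 1) {i : ZMod n} (hi : t i) :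
    ∃ d : ℕ, 4 ≤ d ∧ d ≤ 7 ∧ t (i + d) ∧ (∀ c : ℕ, 0 < c → c < d → ¬t (i + c)) ∧
      (slack t X Y Z (i + d) = 0 →
        (d = 5 ∧ IsRight t X Y i ∧ IsLeft t X Y (i + d) ∧ IsFree t Z (i + 4)) ∨
        (d = 7 ∧ IsLeft t X Y i ∧ IsRight t X Y (i + d))) := by
  obtain ⟨d, d4, d7, hd, hlt⟩ := h.exists_next hn hf hz hi
  refine ⟨d, d4, d7, hd, hlt, fun h0 => ?_⟩
  have s' := h.spaced _ hi
  rcases start_cases hn h hf hz hs hd with H | H | H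
  · right
    have hl := H.2.1
    have s := h.spaced _ hl.1
    interval_cases d
    · push_cast at s
      exact absurd hi (by simpa [show i + 4 - 7 + 3 = i by ring] using s.2.2)
    · push_cast at s
      exact absurd hi (by simpa [show i + 5 - 7 + 2 = i by ring] using s.2.1)
    · push_cast at s
      exact absurd hi (by simpa [show i + 6 - 7 + 1 = i by ring] using s.1)
    · push_cast at hl
      rw [add_sub_cancel_right] at hl
      exact ⟨rfl, hl, H.1⟩
  · left
    have hl := H.2.1
    have s := h.spaced _ hl.1
    interval_cases d
    · push_cast at s
      exact absurd hi (by simpa [show i + 4 - 5 + 1 = i by ring] using s.1)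
    · have hF := H.2.2.1
      push_cast at hl hF
      rw [add_sub_cancel_right] at hl
      rw [show i + 5 - 1 = i + 4 by ring] at hF
      exact ⟨rfl, hl, H.1, hF⟩
    · push_cast at hl
      exact absurd hl.1 (by simpa [show i + 6 - 5 = i + 1 by ring] using s'.1)
    · push_cast at hl
      exact absurd hl.1 (by simpa [show i + 7 - 5 = i + 2 by ring] using s'.2.1)
  · omega

theorem IsLeft.isFree_of_slack (hn : 11 ≤ n) (h : IsBlockStart t X Y Z)
    (hf : ∀ t', IsBlockStart t' X Y Z → t' = t) (hz : ∀ i, ¬Z i)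
    (hs : ∀ i, slack t X Y Z i ≤ 1) {i : ZMod n} (hi : IsLeft t X Y i)
    (h0 : slack t X Y Z i = 0) : IsFree t Z (i - 1) := by
  rcases start_cases hn h hf hz hs hi.1 with H | H | H
  · exact H.2.2.1
  · exact H.2.2.1
  · omega

/-- Going backwards from `p` through blocks without slack, the inner marks keep their position
modulo three. -/
theorem chain (hn : 11 ≤ n) (h : IsBlockStart t X Y Z)
    (hf : ∀ t', IsBlockStart t' X Y Z → t' = t) (hz : ∀ i, ¬Z i)
    (hs : ∀ i, slack t X Y Z i ≤ 1) {p : ZMod n} (hp : t p) (N : ℕ)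
    (h0 : ∀ c : ℕ, c < N → t (p - c) → slack t X Y Z (p - c) = 0) (m : ℤ)
    (hm : IsRight t X Y p ∧ m = 2 ∨ IsLeft t X Y p ∧ m = 0) (c : ℕ) (hc : c < N)
    (ht : t (p - c)) :
    (IsRight t X Y (p - c) ∧ 3 ∣ c + m - 2 ∧ (0 < c → IsFree t Z (p - c + 4))) ∨
    (IsLeft t X Y (p - c) ∧ 3 ∣ c + m ∧ IsFree t Z (p - c - 1)) := by
  induction c using Nat.strong_induction_on with
  | _ c ih =>
  rcases Nat.eq_zero_or_pos c with rfl | hpos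
  · have hs0 := h0 0 hc ht
    simp only [Nat.cast_zero, sub_zero, zero_add, lt_irrefl, false_imp_iff, and_true] at *
    rcases hm with ⟨hm, rfl⟩ | ⟨hm, rfl⟩
    · exact Or.inl ⟨hm, by norm_num⟩
    · exact Or.inr ⟨hm, by norm_num, hm.isFree_of_slack hn h hf hz hs hs0⟩
  obtain ⟨d, d4, d7, hd, hlt, hnext⟩ := next_block hn h hf hz hs ht
  have hdc : d ≤ c := by
    by_contra hlt'
    exact hlt c hpos (by omega) (by rwa [sub_add_cancel])
  rw [show p - c + d = p - ((c - d : ℕ) : ZMod n) by rw [Nat.cast_sub hdc]; ring] at hd hnext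
  have ih := ih (c - d) (by omega) (by omega) hd
  rcases hnext (h0 (c - d) (by omega) hd) with ⟨rfl, H1, H2, H3⟩ | ⟨rfl, H1, H2⟩
  · refine Or.inl ⟨H1, ?_, fun _ => H3⟩
    rcases ih with ⟨ih, _⟩ | ⟨_, ih, _⟩
    · exact absurd H2 (ih.not_isLeft h hf)
    · omega
  · refine Or.inr ⟨H1, ?_, H1.isFree_of_slack hn h hf hz hs (h0 c hc ht)⟩
    rcases ih with ⟨_, ih, _⟩ | ⟨ih, _⟩
    · omega
    · exact absurd ih (H2.not_isLeft h hf)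

/-- No matching containing the marks has, for any `i`, both the edge `u_i u_{i+2}` and the spoke
at `i + 1`. -/
def ExcludesOdd (X Y Z : ZMod n → Prop) : Prop :=
  ∀ x y z, IsConfig x y z → (∀ i, X i → x i) → (∀ i, Y i → y i) → (∀ i, Z i → z i) →
    ∀ i, ¬(x i ∧ z (i + 1))

/-- The matching consisting of `C` blocks only. -/
theorem ExcludesOdd.not_three_dvd (hodd : ExcludesOdd X Y Z) (h3 : 3 ∣ n) (hX : ∀ i, ¬X i)
    (hZ : ∀ i, ¬Z i) (a : ZMod 3) : ¬∀ i, Y i → ZMod.castHom h3 (ZMod 3) i = a := by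
  intro hY
  set φ := ZMod.castHom h3 (ZMod 3)
  obtain ⟨i, hi⟩ := ZMod.ringHom_surjective φ (a + 1)
  have key : ∀ a b : ZMod 3, ExactlyOne (b = a + 1) (b - 2 = a + 1) (b = a + 2) ∧
      ExactlyOne (b = a) (b - 1 = a) (b = a + 2) := by
    unfold ExactlyOne
    decide
  refine hodd (fun i => φ i = a + 1) (fun i => φ i = a) (fun i => φ i = a + 2) (fun i => ?_)
    (fun i hi => absurd hi (hX i)) hY (fun i hi => absurd hi (hZ i)) i ⟨hi, ?_⟩
  · simp only [map_sub, map_one, map_ofNat]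
    exact key a (φ i)
  · simp only [map_add, map_one, hi]
    ring

/-- The outer edges of the matching `D D C ⋯ C`. -/
def IsOuterDDC (j : ℕ) : Prop := j = 0 ∨ j = 1 ∨ j = 4 ∨ j = 5 ∨ (8 ≤ j ∧ j % 3 = 2)

/-- The inner edges of the matching `D D C ⋯ C`. -/
def IsInnerDDC (j : ℕ) : Prop := j = 1 ∨ j = 3 ∨ j = 5 ∨ j = 7 ∨ (10 ≤ j ∧ j % 3 = 1)

theorem ExcludesOdd.not_ddc (hn : 11 ≤ n) (hodd : ExcludesOdd X Y Z) (hn3 : n % 3 = 2)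
    (hZ : ∀ i, ¬Z i) (b : ZMod n) (hX : ∀ i, X i → IsOuterDDC (i - b).val) :
    ¬∀ i, Y i → IsInnerDDC (i - b).val := by
  intro hY
  have : NeZero n := ⟨by omega⟩
  have v1 : ∀ j : ZMod n, (j - 1).val = if j.val = 0 then n - 1 else j.val - 1 := by
    intro j
    obtain ⟨m, hm, rfl⟩ : ∃ m < n, (m : ZMod n) = j := ⟨j.val, j.val_lt, by simp⟩
    rw [ZMod.val_cast_of_lt hm]
    split_ifs with h0
    · subst h0
      have : ((0 : ℕ) : ZMod n) - 1 = ((n - 1 : ℕ) : ZMod n) := by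
        rw [Nat.cast_sub (by omega)]
        simp
      rw [this, ZMod.val_cast_of_lt (by omega)]
    · have : (m : ZMod n) - 1 = ((m - 1 : ℕ) : ZMod n) := by
        rw [Nat.cast_sub (by omega)]
        simp
      rw [this, ZMod.val_cast_of_lt (by omega)]
  have v2 : ∀ j : ZMod n, (j - 2).val =
      if j.val = 0 then n - 2 else if j.val = 1 then n - 1 else j.val - 2 := by
    intro j
    have := j.val_lt
    rw [show j - 2 = j - 1 - 1 by ring, v1, v1]
    split_ifs <;> omega
  have vn : ∀ m < n, ((b + (m : ℕ) : ZMod n) - b).val = m := by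
    intro m hm
    rw [add_sub_cancel_left, ZMod.val_cast_of_lt hm]
  refine hodd (fun i => IsOuterDDC (i - b).val) (fun i => IsInnerDDC (i - b).val)
    (fun i => 9 ≤ (i - b).val ∧ (i - b).val % 3 = 0) (fun i => ?_) hX hY
    (fun i hi => absurd hi (hZ i)) (b + (8 : ℕ)) ⟨?_, ?_⟩
  · have := (i - b).val_lt
    beta_reduce
    rw [show i - 2 - b = i - b - 2 by ring, show i - 1 - b = i - b - 1 by ring, v1, v2]
    generalize (i - b).val = j at *
    unfold ExactlyOne IsOuterDDC IsInnerDDC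
    constructor <;> split_ifs <;> omega
  · rw [vn 8 (by omega)]
    unfold IsOuterDDC
    omega
  · rw [show b + (8 : ℕ) + 1 = b + (9 : ℕ) by push_cast; ring, vn 9 (by omega)]
    omega

/-- It suffices to look at the marks of each block. -/
theorem IsBlockStart.forall_mark (h : IsBlockStart t X Y Z) {P Q : ZMod n → Prop}
    (hPQ : ∀ i, t i → (X i → P i) ∧ (X (i + 1) → P (i + 1)) ∧ (Y i → Q i) ∧
      (Y (i + 2) → Q (i + 2))) :
    (∀ i, X i → P i) ∧ ∀ i, Y i → Q i := by
  constructor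
  · intro i hi
    rcases h.outer i hi with H | H
    · exact (hPQ _ H).1 hi
    · have := (hPQ _ H).2.1
      rw [sub_add_cancel] at this
      exact this hi
  · intro i hi
    rcases h.inner i hi with H | H
    · exact (hPQ _ H).2.2.1 hi
    · have := (hPQ _ H).2.2.2
      rw [sub_add_cancel] at this
      exact this hi

theorem sum_slack_ne_zero [NeZero n] (hn : 11 ≤ n) (h : IsBlockStart t X Y Z)
    (hf : ∀ t', IsBlockStart t' X Y Z → t' = t) (hodd : ExcludesOdd X Y Z)
    (hz : ∀ i, ¬Z i) (hs : ∀ i, slack t X Y Z i = 0) (h3 : 3 ∣ n) : False := by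
  have hs1 : ∀ i, slack t X Y Z i ≤ 1 := fun i => by rw [hs]; norm_num
  obtain ⟨p, hp⟩ : ∃ p, t p := by
    by_contra! hc
    exact h.not_four_free hn hf 0 ⟨hz _, hc _, hc _, hc _, hc _⟩ ⟨hz _, hc _, hc _, hc _, hc _⟩
      ⟨hz _, hc _, hc _, hc _, hc _⟩ ⟨hz _, hc _, hc _, hc _, hc _⟩
  obtain ⟨m, hm⟩ : ∃ m : ℤ, IsRight t X Y p ∧ m = 2 ∨ IsLeft t X Y p ∧ m = 0 := by
    rcases start_cases hn h hf hz hs1 hp with H | H | H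
    · exact ⟨2, Or.inl ⟨H.1, rfl⟩⟩
    · exact ⟨0, Or.inr ⟨H.1, rfl⟩⟩
    · have := hs p
      omega
  have key := h.forall_mark (P := fun _ => False)
    (Q := fun i => ZMod.castHom h3 (ZMod 3) i = ZMod.castHom h3 (ZMod 3) p + m) (fun q hq => ?_)
  · exact hodd.not_three_dvd h3 key.1 hz _ key.2
  obtain ⟨c, hc0, hcn, rfl⟩ : ∃ c : ℕ, 0 < c ∧ c ≤ n ∧ q = p - c := by
    by_cases h0 : (p - q).val = 0
    · refine ⟨n, by omega, le_rfl, ?_⟩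
      rw [ZMod.val_eq_zero] at h0
      simp [← sub_eq_zero.1 h0]
    · refine ⟨(p - q).val, by omega, (ZMod.val_lt _).le, by simp⟩
  have hdvd : ∀ k : ℤ, 3 ∣ k → ((k : ℤ) : ZMod 3) = 0 := fun k hk =>
    (ZMod.intCast_zmod_eq_zero_iff_dvd k 3).2 (by exact_mod_cast hk)
  rcases chain hn h hf hz hs1 hp (n + 1) (fun c _ _ => hs _) m hm c (by omega) hq with
    ⟨H, H1, H2⟩ | ⟨H, H1, H2⟩
  · have hmk := H.inner_mark hn h hf (H2 hc0)
    refine ⟨H.2.1, hmk.2, fun hy => absurd hy H.2.2.1, fun _ => ?_⟩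
    have := hdvd _ H1
    simp only [map_add, map_sub, map_natCast, map_ofNat]
    push_cast at this
    linear_combination -this
  · have hmk := H.inner_mark hn h hf H2
    refine ⟨hmk.2, H.2.1, fun _ => ?_, fun hy => absurd hy H.2.2.1⟩
    have := hdvd _ H1
    simp only [map_sub, map_natCast]
    push_cast at this
    linear_combination -this

/-- The marks of the block starting at `q` belong to the matching `D D C ⋯ C` starting at `b`. -/
def FitsDDC (X Y : ZMod n → Prop) (b q : ZMod n) : Prop :=
  (X q → IsOuterDDC (q - b).val) ∧ (X (q + 1) → IsOuterDDC (q + 1 - b).val) ∧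
    (Y q → IsInnerDDC (q - b).val) ∧ (Y (q + 2) → IsInnerDDC (q + 2 - b).val)

theorem sum_slack_ne_one (hn : 11 ≤ n) (h : IsBlockStart t X Y Z)
    (hf : ∀ t', IsBlockStart t' X Y Z → t' = t) (hodd : ExcludesOdd X Y Z)
    (hz : ∀ i, ¬Z i) (hn3 : n % 3 = 2) (hs : ∀ i, slack t X Y Z i ≤ 1) {e : ZMod n} (he : t e)
    (hs0 : ∀ i, i ≠ e → slack t X Y Z i = 0) (d : ℕ) (hd4 : 4 ≤ d) (hd6 : d ≤ 6)
    (hp : t (e - d)) (m s : ℤ)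
    (hm : IsRight t X Y (e - d) ∧ m = 2 ∨ IsLeft t X Y (e - d) ∧ m = 0) (b : ZMod n)
    (hb : e - d = b + s) (hsm : (s + m) % 3 = 2) (hsd : 1 ≤ s + d) 
    (hs3 : s ≤ 1 ∨ s ≤ 3 ∧ m = 2) (hfe : FitsDDC X Y b e) (hfp : FitsDDC X Y b (e - d)) :
    False := by
  have : NeZero n := ⟨by omega⟩
  set p := e - (d : ZMod n) with hpdef
  have key := h.forall_mark (P := fun i => IsOuterDDC (i - b).val)
    (Q := fun i => IsInnerDDC (i - b).val) (fun q hq => ?_)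
  · exact hodd.not_ddc hn hn3 hz b key.1 key.2
  change FitsDDC X Y b q
  have hno : ∀ {i : ZMod n}, t i → ∀ k : ℕ, 0 < k → k < 4 → ¬t (i + k) := by
    intro i hi k h0 h4
    have := h.spaced i hi
    interval_cases k <;> push_cast <;> tauto
  obtain ⟨c, hcn, rfl⟩ : ∃ c : ℕ, c < n ∧ q = p - c :=
    ⟨(p - q).val, ZMod.val_lt _, by simp⟩
  rcases Nat.eq_zero_or_pos c with rfl | hc0
  · simpa using hfp
  have hn0 : ((n : ℕ) : ZMod n) = 0 := ZMod.natCast_self n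
  have hc4 : 4 ≤ c := by
    by_contra hlt
    exact hno hq c hc0 (by omega) (by rwa [sub_add_cancel])
  have hpc : (p - c : ZMod n) + (c + d - n : ℤ) = e := by
    push_cast
    rw [hpdef, hn0]
    ring
  rcases lt_trichotomy (c + d) n with hlt | heq | hgt
  · have hcd : c + d + 4 ≤ n := by
      by_contra hlt'
      refine hno he (n - (c + d)) (by omega) (by omega) ?_
      rw [Nat.cast_sub hlt.le, hn0]
      rwa [show e + (0 - ((c + d : ℕ) : ZMod n)) = p - c by rw [hpdef]; push_cast; ring]
    have hne : ∀ c' : ℕ, c' < n - d → t (p - c') → slack t X Y Z (p - c') = 0 := by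
      intro c' hc' _
      apply hs0
      rw [hpdef]
      intro heq
      have h1 : ((d + c' : ℕ) : ZMod n) = 0 := by
        push_cast
        linear_combination -heq
      rw [ZMod.natCast_eq_zero_iff] at h1
      exact absurd (Nat.le_of_dvd (by omega) h1) (by omega)
    have hval : ∀ k : ℕ, k ≤ 2 → n + s - c + k < n →
        ((p - c : ZMod n) + k - b).val = (n + s - c + k).toNat := by
      intro k hk hkn
      have : (p - c : ZMod n) + k - b = (((n + s - c + k).toNat : ℕ) : ZMod n) := by
        have h1 : (((n + s - c + k).toNat : ℤ) : ZMod n) = ((n + s - c + k : ℤ) : ZMod n) := by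
          rw [Int.toNat_of_nonneg (by omega)]
        rw [Int.cast_natCast] at h1
        rw [h1, hb]
        push_cast
        rw [hn0]
        ring
      rw [this, ZMod.val_cast_of_lt (by omega)]
    rcases chain hn h hf hz hs hp (n - d) hne m hm c (by omega) hq with ⟨H, H1, H2⟩ | ⟨H, H1, H2⟩
    · have hmk := H.inner_mark hn h hf (H2 hc0)
      refine ⟨fun hx => absurd hx H.2.1, fun hx => absurd hx hmk.2,
        fun hy => absurd hy H.2.2.1, fun _ => ?_⟩
      have := hval 2 le_rfl (by omega)
      push_cast at this
      rw [this]
      unfold IsInnerDDC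
      omega
    · have hmk := H.inner_mark hn h hf H2
      refine ⟨fun hx => absurd hx hmk.2, fun hx => absurd hx H.2.1, fun _ => ?_,
        fun hy => absurd hy H.2.2.1⟩
      have := hval 0 (by omega) (by omega)
      push_cast at this
      rw [add_zero] at this
      rw [this]
      unfold IsInnerDDC
      omega
  · have : p - c = e := by
      rw [← hpc, show (c + d - n : ℤ) = 0 by omega]
      simp
    rwa [this]
  · exfalso
    by_cases h3 : c + d - n < 4
    · refine hno hq (c + d - n) (by omega) h3 ?_
      rw [Nat.cast_sub hgt.le, hn0]
      rwa [show p - c + (((c + d : ℕ) : ZMod n) - 0) = e by rw [hpdef]; push_cast; ring]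
    · refine hno hp (n - c) (by omega) (by omega) ?_
      rw [Nat.cast_sub hcn.le, hn0]
      rwa [show p + (0 - (c : ZMod n)) = p - c by ring]

theorem slack_nonneg (hn : 11 ≤ n) (h : IsBlockStart t X Y Z)
    (hf : ∀ t', IsBlockStart t' X Y Z → t' = t) (i : ZMod n) : 0 ≤ slack t X Y Z i := by
  by_cases hi : t i
  · have := neg_two_le_phi hn h hf (i - 1)
    rcases slack_start_cases hn h hf hi with H | H | H <;> omega
  · by_cases hz : Z i
    · have := two_le_slack_of_spoke hn h hf hz
      omega
    · exact (slack_eq_zero hn h hf hi hz).ge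

theorem two_le_sum_slack [NeZero n] (hn : 11 ≤ n) (h : IsBlockStart t X Y Z)
    (hf : ∀ t', IsBlockStart t' X Y Z → t' = t) (hodd : ExcludesOdd X Y Z) :
    2 ≤ ∑ i, slack t X Y Z i := by
  by_contra! hlt
  have h0 := slack_nonneg hn h hf
  have hs : ∀ i, slack t X Y Z i ≤ 1 := fun i => by
    have := Finset.single_le_sum (fun j _ => h0 j) (Finset.mem_univ i)
    omega
  have hz : ∀ i, ¬Z i := fun i hi => by
    have := two_le_slack_of_spoke hn h hf hi
    have := hs i
    omega
  have hsum := sum_slack h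
  by_cases hall : ∀ i, slack t X Y Z i = 0
  · simp only [hall, Finset.sum_const_zero] at hsum
    exact sum_slack_ne_zero hn h hf hodd hz hall (by omega)
  push Not at hall
  obtain ⟨e, hne⟩ := hall
  have hs0 : ∀ i, i ≠ e → slack t X Y Z i = 0 := fun i hi => by
    have h1 := Finset.sum_le_sum_of_subset_of_nonneg (Finset.subset_univ {i, e})
      (fun j _ _ => h0 j)
    rw [Finset.sum_pair hi] at h1
    have := h0 i
    have := h0 e
    omega
  have hn3 : n % 3 = 2 := by
    have h1 := Finset.single_le_sum (fun j _ => h0 j) (Finset.mem_univ e)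
    have := h0 e
    omega
  have he : t e := by
    by_contra he
    exact hne (slack_eq_zero hn h hf he (hz e))
  have hnz : ∀ k : ℕ, 0 < k → k < 11 → slack t X Y Z (e + k) = 0 := fun k hk hk' => by
    refine hs0 _ fun heq => natCast_zmod_ne_zero hn k hk hk' ?_
    simpa using heq
  have hnz' : ∀ k : ℕ, 0 < k → k < 11 → slack t X Y Z (e - k) = 0 := fun k hk hk' => by
    refine hs0 _ fun heq => natCast_zmod_ne_zero hn k hk hk' ?_
    simpa using heq
  have hvn : ∀ (i b : ZMod n) (k : ℕ), k < n → i = b + k → (i - b).val = k := by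
    rintro i b k hk rfl
    rw [add_sub_cancel_left, ZMod.val_cast_of_lt hk]
  have hn0 : ((n : ℕ) : ZMod n) = 0 := ZMod.natCast_self n
  have hvn' : ∀ (i b : ZMod n) (k : ℕ), k < n → 0 < k → i + k = b → (i - b).val = n - k := by
    rintro i b k hk h0 rfl
    refine hvn _ _ _ (by omega) ?_
    rw [Nat.cast_sub hk.le, hn0]
    ring
  have step := sum_slack_ne_one hn h hf hodd hz hn3 hs he hs0
  have hR : IsRight t X Y e → Y (e + 2) ∧ ¬X (e + 1) := fun H => by
    obtain ⟨d, d4, d7, hd, -, hnext⟩ := next_block hn h hf hz hs he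
    rcases hnext (hnz d (by omega) (by omega)) with ⟨-, -, -, h4⟩ | ⟨-, h4, -⟩
    · exact H.inner_mark hn h hf h4
    · exact absurd h4 (H.not_isLeft h hf)
  have hL : ∀ k : ℕ, 0 < k → k < 11 → IsLeft t X Y (e - k) → Y (e - k) ∧ ¬X (e - k) :=
    fun k h1 h2 H => H.inner_mark hn h hf (H.isFree_of_slack hn h hf hz hs (hnz' k h1 h2))
  rcases start_cases hn h hf hz hs he with H | H | ⟨-, ⟨H, Hp | Hp⟩ | ⟨H, Hp | Hp⟩⟩
  · exact hne H.2.2.2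
  · exact hne H.2.2.2
  · have hm := hL 6 (by norm_num) (by norm_num) (by exact_mod_cast Hp)
    have hme := hR H
    push_cast at hm
    refine step 6 (by norm_num) (by norm_num) (by exact_mod_cast Hp.1) 0 (-1)
      (Or.inr ⟨by exact_mod_cast Hp, rfl⟩) (e - 5) (by push_cast; ring) (by norm_num) (by norm_num)
      (by norm_num) ⟨fun hx => absurd hx H.2.1, fun hx => absurd hx hme.2,
        fun hx => absurd hx H.2.2.1, fun _ => ?_⟩ ?_
    · rw [hvn _ _ 7 (by omega) (by push_cast; ring)]
      unfold IsInnerDDC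
      omega
    · push_cast
      refine ⟨fun hx => absurd hx hm.2, fun hx => absurd hx Hp.2.1, fun _ => ?_,
        fun hx => absurd hx Hp.2.2.1⟩
      rw [hvn' _ _ 1 (by omega) (by omega) (by push_cast; ring)]
      unfold IsInnerDDC
      omega
  · have hme := hR H
    refine step 5 (by norm_num) (by norm_num) (by exact_mod_cast Hp.1) 2 3
      (Or.inl ⟨by exact_mod_cast Hp, rfl⟩) (e - 8) (by push_cast; ring) (by norm_num) (by norm_num)
      (by norm_num) ⟨fun hx => absurd hx H.2.1, fun hx => absurd hx hme.2,
        fun hx => absurd hx H.2.2.1, fun _ => ?_⟩ ?_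
    · rw [hvn _ _ 10 (by omega) (by push_cast; ring)]
      unfold IsInnerDDC
      omega
    · push_cast
      refine ⟨fun hx => absurd hx Hp.2.1, fun _ => ?_, fun hx => absurd hx Hp.2.2.1,
        fun _ => ?_⟩
      · rw [hvn _ _ 4 (by omega) (by push_cast; ring)]
        unfold IsOuterDDC
        omega
      · rw [hvn _ _ 5 (by omega) (by push_cast; ring)]
        unfold IsInnerDDC
        omega
  · by_cases hy : Y e
    · have hx : ¬X e := fun hx => H.2.2.2 ⟨hx, hy⟩
      refine step 4 (by norm_num) (by norm_num) (by exact_mod_cast Hp.1) 2 3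
        (Or.inl ⟨by exact_mod_cast Hp, rfl⟩) (e - 7) (by push_cast; ring) (by norm_num)
        (by norm_num) (by norm_num) ⟨fun hx' => absurd hx' hx, fun hx => absurd hx H.2.1,
          fun _ => ?_, fun hx => absurd hx H.2.2.1⟩ ?_
      · rw [hvn _ _ 7 (by omega) (by push_cast; ring)]
        unfold IsInnerDDC
        omega
      · push_cast
        refine ⟨fun hx => absurd hx Hp.2.1, fun _ => ?_, fun hx => absurd hx Hp.2.2.1,
          fun _ => ?_⟩
        · rw [hvn _ _ 4 (by omega) (by push_cast; ring)]
          unfold IsOuterDDC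
          omega
        · rw [hvn _ _ 5 (by omega) (by push_cast; ring)]
          unfold IsInnerDDC
          omega
    by_cases hpx : X (e - 4 + 1)
    · have hpy : ¬Y (e - 4 + 2) := fun hpy => Hp.2.2.2 ⟨hpx, hpy⟩
      refine step 4 (by norm_num) (by norm_num) (by exact_mod_cast Hp.1) 2 0
        (Or.inl ⟨by exact_mod_cast Hp, rfl⟩) (e - 4) (by push_cast; ring) (by norm_num)
        (by norm_num) (by norm_num) ⟨fun _ => ?_, fun hx => absurd hx H.2.1,
          fun hx => absurd hx hy, fun hx => absurd hx H.2.2.1⟩ ?_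
      · rw [hvn _ _ 4 (by omega) (by push_cast; ring)]
        unfold IsOuterDDC
        omega
      · push_cast
        refine ⟨fun hx => absurd hx Hp.2.1, fun _ => ?_, fun hx => absurd hx Hp.2.2.1,
          fun hx => absurd hx hpy⟩
        rw [hvn _ _ 1 (by omega) (by push_cast; ring)]
        unfold IsOuterDDC
        omega
    · refine step 4 (by norm_num) (by norm_num) (by exact_mod_cast Hp.1) 2 (-3)
        (Or.inl ⟨by exact_mod_cast Hp, rfl⟩) (e - 1) (by push_cast; ring) (by norm_num)
        (by norm_num) (by norm_num) ⟨fun _ => ?_, fun hx => absurd hx H.2.1,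
          fun hx => absurd hx hy, fun hx => absurd hx H.2.2.1⟩ ?_
      · rw [hvn _ _ 1 (by omega) (by push_cast; ring)]
        unfold IsOuterDDC
        omega
      · push_cast
        refine ⟨fun hx => absurd hx Hp.2.1, fun hx => absurd hx hpx,
          fun hx => absurd hx Hp.2.2.1, fun _ => ?_⟩
        rw [hvn' _ _ 1 (by omega) (by omega) (by push_cast; ring)]
        unfold IsInnerDDC
        omega
  · have hm := hL 5 (by norm_num) (by norm_num) (by exact_mod_cast Hp)
    push_cast at hm
    refine step 5 (by norm_num) (by norm_num) (by exact_mod_cast Hp.1) 0 (-4)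
      (Or.inr ⟨by exact_mod_cast Hp, rfl⟩) (e - 1) (by push_cast; ring) (by norm_num) (by norm_num)
      (by norm_num) ⟨fun _ => ?_, fun hx => absurd hx H.2.1, fun _ => ?_,
        fun hx => absurd hx H.2.2.1⟩ ?_
    · rw [hvn _ _ 1 (by omega) (by push_cast; ring)]
      unfold IsOuterDDC
      omega
    · rw [hvn _ _ 1 (by omega) (by push_cast; ring)]
      unfold IsInnerDDC
      omega
    · push_cast
      refine ⟨fun hx => absurd hx hm.2, fun hx => absurd hx Hp.2.1, fun _ => ?_,
        fun hx => absurd hx Hp.2.2.1⟩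
      rw [hvn' _ _ 4 (by omega) (by omega) (by push_cast; ring)]
      unfold IsInnerDDC
      omega
end LowerBound

section BlockStructure

variable {n : ℕ} {t x y z : ZMod n → Prop}

/-- `t` is the set of starting positions of the `A` blocks of a concatenation of `A` and `B`
blocks, with edges given by `x`, `y`, `z`. -/
structure IsBlockConfig (t x y z : ZMod n → Prop) : Prop where
  spaced : ∀ i, t i → ¬t (i + 1) ∧ ¬t (i + 2) ∧ ¬t (i + 3)
  outer : ∀ i, x i ↔ t i ∨ t (i - 1)
  inner : ∀ i, y i ↔ t i ∨ t (i - 2)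
  spoke : ∀ i, z i ↔ ¬t i ∧ ¬t (i - 1) ∧ ¬t (i - 2) ∧ ¬t (i - 3)

theorem IsBlockConfig.iff (h : IsBlockConfig t x y z) (i : ZMod n) : t i ↔ x i ∧ y i := by
  have s := h.spaced (i - 2)
  rw [show i - 2 + 1 = i - 1 by ring] at s
  rw [h.outer, h.inner]
  tauto

theorem IsBlockConfig.isConfig (h : IsBlockConfig t x y z) : IsConfig x y z := by
  intro i
  have s1 := h.spaced (i - 1)
  have s2 := h.spaced (i - 2)
  have s3 := h.spaced (i - 3)
  rw [show i - 1 + 1 = i by ring] at s1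
  rw [show i - 2 + 1 = i - 1 by ring, show i - 2 + 2 = i by ring] at s2
  rw [show i - 3 + 1 = i - 2 by ring, show i - 3 + 2 = i - 1 by ring,
    show i - 3 + 3 = i by ring] at s3
  have x0 := h.outer i
  have x2 := h.outer (i - 2)
  have y0 := h.inner i
  have y1 := h.inner (i - 1)
  have z0 := h.spoke i
  rw [show i - 2 - 1 = i - 3 by ring] at x2
  rw [show i - 1 - 2 = i - 3 by ring] at y1
  rw [x0, x2, y0, y1, z0]
  clear x0 x2 y0 y1 z0
  unfold ExactlyOne
  by_cases a0 : t i <;> by_cases a1 : t (i - 1) <;> by_cases a2 : t (i - 2) <;>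
    by_cases a3 : t (i - 3) <;> simp_all

/-- The parity of the number of edges joining the columns before `i` to the others. -/
def IsEvenCut (x y : ZMod n → Prop) (i : ZMod n) : Prop :=
  ¬Xor (x (i - 2)) (Xor (x (i - 1)) (y (i - 1)))

theorem IsConfig.isEvenCut_succ (h : IsConfig x y z) {i : ZMod n} (hi : IsEvenCut x y i) :
    IsEvenCut x y (i + 1) := by
  have := h i
  unfold IsEvenCut at *
  rw [show i + 1 - 2 = i - 1 by ring, add_sub_cancel_right]
  unfold ExactlyOne at this
  by_cases a0 : x i <;> by_cases a1 : x (i - 1) <;> by_cases a2 : x (i - 2) <;>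
    by_cases a3 : y i <;> by_cases a4 : y (i - 1) <;> simp_all

theorem IsConfig.isEvenCut [NeZero n] (h : IsConfig x y z) {i : ZMod n} (hi : IsEvenCut x y i)
    (j : ZMod n) : IsEvenCut x y j := by
  have key : ∀ k : ℕ, IsEvenCut x y (i + k) := by
    intro k
    induction k with
    | zero => simpa using hi
    | succ k ih => simpa [add_assoc] using h.isEvenCut_succ ih
  simpa using key (j - i).val

theorem spoke_iff_of_exactlyOne {x₀ x₂ y₀ y₁ z₀ t₀ t₁ t₂ t₃ : Prop} (hx : ExactlyOne x₀ x₂ z₀)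
    (hy : ExactlyOne y₀ y₁ z₀) (hx₀ : x₀ ↔ t₀ ∨ t₁) (hx₂ : x₂ ↔ t₂ ∨ t₃) (hy₀ : y₀ ↔ t₀ ∨ t₂)
    (hy₁ : y₁ ↔ t₁ ∨ t₃) : z₀ ↔ ¬t₀ ∧ ¬t₁ ∧ ¬t₂ ∧ ¬t₃ := by
  rw [hx₀, hx₂] at hx
  rw [hy₀, hy₁] at hy
  unfold ExactlyOne at hx hy
  clear hx₀ hx₂ hy₀ hy₁
  grind

theorem IsConfig.isBlockConfig (h : IsConfig x y z) (he : ∀ i, IsEvenCut x y i) :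
    IsBlockConfig (fun i => x i ∧ y i) x y z := by
  have hx : ∀ i, x i ↔ (x i ∧ y i) ∨ (x (i - 1) ∧ y (i - 1)) := by
    intro i
    have h0 := h i
    have e0 := he i
    unfold IsEvenCut at e0
    unfold ExactlyOne at h0
    by_cases a0 : x i <;> by_cases a1 : x (i - 1) <;> by_cases a2 : x (i - 2) <;>
      by_cases a3 : y i <;> by_cases a4 : y (i - 1) <;> simp_all
  have hy : ∀ i, y i ↔ (x i ∧ y i) ∨ (x (i - 2) ∧ y (i - 2)) := by
    intro i
    have h0 := h i
    have h1 := (h (i - 1)).2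
    have x1 := hx (i - 1)
    have x0 := hx i
    have e0 := he i
    rw [show i - 1 - 1 = i - 2 by ring] at h1 x1
    unfold IsEvenCut at e0
    unfold ExactlyOne at h0 h1
    clear h he hx
    grind
  refine ⟨fun i hi => ?_, hx, hy, fun i => ?_⟩
  · have h1 := (h (i + 1)).2
    have h2 := (h (i + 2)).1
    have h3 := (h (i + 3)).2
    have hy2 := hy (i + 2)
    rw [add_sub_cancel_right] at h1 h2 hy2
    rw [show i + 3 - 1 = i + 2 by ring] at h3
    unfold ExactlyOne at h1 h2 h3
    tauto
  · have hx2 := hx (i - 2)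
    have hy1 := hy (i - 1)
    rw [show i - 2 - 1 = i - 3 by ring] at hx2
    rw [show i - 1 - 2 = i - 3 by ring] at hy1
    exact spoke_iff_of_exactlyOne (h i).1 (h i).2 (hx i) hx2 (hy i) hy1

theorem IsType1.exists_isEvenCut (hn : 11 ≤ n) {M : (petersen n).Subgraph} (h1 : IsType1 M)
    (h : IsConfig (fun i : ZMod n => M.Adj (pu i) (pu (i + 2)))
      (fun i => M.Adj (pv i) (pv (i + 1))) (fun i => M.Adj (pu i) (pv i))) :
    ∃ i, IsEvenCut (fun i : ZMod n => M.Adj (pu i) (pu (i + 2)))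
      (fun i => M.Adj (pv i) (pv (i + 1))) i := by
  obtain ⟨i, L, hL, hM⟩ := h1
  have hA : ∀ j, blockA n j ⊆ M.edgeSet →
      ∃ i, IsEvenCut (fun i : ZMod n => M.Adj (pu i) (pu (i + 2)))
      (fun i => M.Adj (pv i) (pv (i + 1))) i := by
    intro j hj
    refine ⟨j + 2, ?_⟩
    have a1 : M.Adj (pu j) (pu (j + 2)) := hj (a := s(pu j, pu (j + 2))) (by simp [blockA])
    have a2 : M.Adj (pu (j + 1)) (pu (j + 1 + 2)) :=
      hj (a := s(pu (j + 1), pu (j + 1 + 2))) (by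
        rw [show j + 1 + 2 = j + 3 by ring]
        simp [blockA])
    have a3 : M.Adj (pv j) (pv (j + 1)) := hj (a := s(pv j, pv (j + 1))) (by simp [blockA])
    have h1 := (h (j + 1)).2
    rw [add_sub_cancel_right] at h1
    unfold IsEvenCut
    rw [add_sub_cancel_right, show j + 2 - 1 = j + 1 by ring]
    unfold ExactlyOne at h1
    simp_all
  match L, hL, hM with
  | [], hL, _ => simp at hL; omega
  | [false], hL, _ => simp [abLen] at hL; omega
  | true :: L, _, hM => exact hA i (by rw [hM, abEdges]; exact Set.subset_union_left)
  | false :: true :: L, _, hM =>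
    refine hA (i + 1) ?_
    rw [hM, abEdges, abEdges]
    exact Set.subset_union_left.trans Set.subset_union_right
  | false :: false :: L, _, hM =>
    refine ⟨i + 1, ?_⟩
    have a1 : M.Adj (pu i) (pv i) := by
      change s(pu i, pv i) ∈ M.edgeSet
      simp [hM, abEdges, blockB]
    have a2 : M.Adj (pu (i + 1)) (pv (i + 1)) := by
      change s(pu (i + 1), pv (i + 1)) ∈ M.edgeSet
      simp [hM, abEdges, blockB]
    have h1 := h i
    have h2 := (h (i + 1)).1
    unfold IsEvenCut
    rw [add_sub_cancel_right]
    unfold ExactlyOne at h1 h2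
    rw [show i + 1 - 2 = i - 1 by ring] at *
    simp_all

open Classical in
theorem sum_ind_le_ncard [NeZero n] (hn : 11 ≤ n) (S : Set (Sym2 (PV n))) :
    ∑ i : ZMod n, (ind (s(pu i, pu (i + 2)) ∈ S) + ind (s(pv i, pv (i + 1)) ∈ S)
      + ind (s(pu i, pv i) ∈ S)) ≤ S.ncard := by
  have hcard : ∀ (f : ZMod n → Sym2 (PV n)), Function.Injective f →
      ∑ i, ind (f i ∈ S) = (((Finset.univ.filter fun i => f i ∈ S).image f).card : ℤ) := by
    intro f hf
    rw [Finset.card_image_of_injective _ hf]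
    simp [ind]
  simp only [Finset.sum_add_distrib]
  rw [hcard (fun i => s(pu i, pu (i + 2))) fun i j => (sym2_pu_inj hn).1,
    hcard (fun i => s(pv i, pv (i + 1))) fun i j => (sym2_pv_inj hn).1,
    hcard (fun i => s(pu i, pv i)) fun i j => by simp [pu, pv]]
  rw [Set.ncard_eq_toFinset_card' S]
  norm_cast
  rw [← Finset.card_union_of_disjoint, ← Finset.card_union_of_disjoint]
  · refine Finset.card_le_card fun e => ?_
    simp only [Finset.mem_union, Finset.mem_image, Finset.mem_filter, Finset.mem_univ, true_and,
      Set.mem_toFinset]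
    rintro ((⟨i, hi, rfl⟩ | ⟨i, hi, rfl⟩) | ⟨i, hi, rfl⟩) <;> exact hi
  · rw [Finset.disjoint_left]
    simp only [Finset.mem_union, Finset.mem_image, Finset.mem_filter, Finset.mem_univ, true_and]
    rintro e (⟨i, hi, rfl⟩ | ⟨i, hi, rfl⟩) ⟨j, hj, h⟩ <;> simp [pu, pv] at h
  · rw [Finset.disjoint_left]
    simp only [Finset.mem_image, Finset.mem_filter, Finset.mem_univ, true_and]
    rintro e ⟨i, hi, rfl⟩ ⟨j, hj, h⟩
    simp [pu, pv] at h

theorem add_two_le_six_mul_forcingNumber (hn : 11 ≤ n) {M : (petersen n).Subgraph}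
    (hM : M.IsPerfectMatching) (h1 : IsType1 M) :
    n + 2 ≤ 6 * forcingNumber (petersen n) M := by
  have : NeZero n := ⟨by omega⟩
  have hc := (isPerfectMatching_iff_isConfig hn M).1 hM
  obtain ⟨i₀, hi₀⟩ := h1.exists_isEvenCut hn hc
  have hb := hc.isBlockConfig (hc.isEvenCut hi₀)
  set x := fun i : ZMod n => M.Adj (pu i) (pu (i + 2))
  set y := fun i : ZMod n => M.Adj (pv i) (pv (i + 1))
  set z := fun i : ZMod n => M.Adj (pu i) (pv i)
  obtain ⟨S, ⟨hSM, hS⟩, hcard⟩ := forcingNumber_spec hM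
  have hforce : ∀ x' y' z', IsConfig x' y' z' → (∀ i : ZMod n, s(pu i, pu (i + 2)) ∈ S → x' i) →
      (∀ i : ZMod n, s(pv i, pv (i + 1)) ∈ S → y' i) →
      (∀ i : ZMod n, s(pu i, pv i) ∈ S → z' i) → x' = x ∧ y' = y ∧ z' = z := by
    intro x' y' z' hc' hx hy hz
    have := hS _ (configSubgraph_isPerfectMatching hn hc') (fun e he => ?_)
    · refine ⟨?_, ?_, ?_⟩ <;> funext i <;> apply propext
      · rw [← configSubgraph_adj_u hn x' y' z', this]
      · rw [← configSubgraph_adj_v hn x' y' z', this]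
      · rw [← configSubgraph_adj_z hn x' y' z', this]
    · obtain ⟨i, rfl | rfl | rfl⟩ := petersen_edge_cases hn (M.edgeSet_subset (hSM he))
      · exact (configSubgraph_adj_u hn x' y' z' i).2 (hx i he)
      · exact (configSubgraph_adj_v hn x' y' z' i).2 (hy i he)
      · exact (configSubgraph_adj_z hn x' y' z' i).2 (hz i he)
  have hstart : IsBlockStart (fun i => x i ∧ y i) (fun i => s(pu i, pu (i + 2)) ∈ S)
      (fun i => s(pv i, pv (i + 1)) ∈ S) (fun i => s(pu i, pv i) ∈ S) :=
    ⟨hb.spaced, fun i hi => (hb.outer i).1 (hSM hi), fun i hi => (hb.inner i).1 (hSM hi),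
      fun i hi => (hb.spoke i).1 (hSM hi)⟩
  have hsum := sum_slack hstart
  have hle := two_le_sum_slack hn hstart (fun t' ht' => ?_) (fun x' y' z' hc' hx hy hz i => ?_)
  · have := sum_ind_le_ncard hn S
    rw [hcard] at this
    omega
  · have hb' : IsBlockConfig t' (fun i => t' i ∨ t' (i - 1)) (fun i => t' i ∨ t' (i - 2))
        (fun i => ¬t' i ∧ ¬t' (i - 1) ∧ ¬t' (i - 2) ∧ ¬t' (i - 3)) :=
      ⟨ht'.spaced, fun _ => Iff.rfl, fun _ => Iff.rfl, fun _ => Iff.rfl⟩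
    obtain ⟨h1, h2, -⟩ := hforce _ _ _ hb'.isConfig ht'.outer ht'.inner ht'.spoke
    funext i
    apply propext
    exact (hb'.iff i).trans (by rw [← h1, ← h2])
  · obtain ⟨rfl, rfl, rfl⟩ := hforce x' y' z' hc' hx hy hz
    rintro ⟨h1, h2⟩
    rw [hb.outer] at h1
    rw [hb.spoke, add_sub_cancel_right, show i + 1 - 2 = i - 1 by ring] at h2
    tauto

end BlockStructure

section UpperBound

/-- Truth values attached to the edges `u_i u_{i+2}`, `v_i v_{i+1}`, `u_i v_i`.  The same type
encodes the part of a perfect matching that crosses into column `i`, namely the truth values of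
`u_{i-2} u_i`, `u_{i-1} u_{i+1}`, `v_{i-1} v_i`. -/
abbrev Column := Bool × Bool × Bool

/-- The state before the next column, when column `c` follows state `s`. -/
def nextState (s c : Column) : Column := (s.2.1, c.1, c.2.1)

/-- The columns containing the mask `m` that may follow state `s` in a perfect matching. -/
def nextColumns (s m : Column) : List Column :=
  ((!s.1, !s.2.2, false) :: bif s.1 || s.2.2 then [] else [(false, false, true)]).filter
    fun c => (!m.1 || c.1) && (!m.2.1 || c.2.1) && (!m.2.2 || c.2.2)

theorem mem_nextColumns {s m c : Column} : c ∈ nextColumns s m ↔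
    ExactlyOne (c.1 = true) (s.1 = true) (c.2.2 = true) ∧
    ExactlyOne (c.2.1 = true) (s.2.2 = true) (c.2.2 = true) ∧
    (m.1 = true → c.1 = true) ∧ (m.2.1 = true → c.2.1 = true) ∧
    (m.2.2 = true → c.2.2 = true) := by
  unfold ExactlyOne
  obtain ⟨s₁, s₂, s₃⟩ := s
  obtain ⟨m₁, m₂, m₃⟩ := m
  obtain ⟨c₁, c₂, c₃⟩ := c
  cases s₁ <;> cases s₃ <;> cases c₁ <;> cases c₂ <;> cases c₃ <;> simp [nextColumns, and_assoc]

/-- All sequences of columns containing the given masks that may follow state `s`, each with its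
final state. -/
def paths : List Column → Column → List (List Column × Column)
  | [], s => [([], s)]
  | m :: ms, s => (nextColumns s m).flatMap fun c =>
      (paths ms (nextState s c)).map fun p => (c :: p.1, p.2)

theorem paths_append (ms ms' : List Column) (s : Column) :
    paths (ms ++ ms') s =
      (paths ms s).flatMap fun p => (paths ms' p.2).map fun q => (p.1 ++ q.1, q.2) := by
  induction ms generalizing s with
  | nil => simp [paths]
  | cons m ms ih =>
    simp [paths, ih, List.flatMap_assoc, List.map_flatMap, List.flatMap_map, Function.comp_def]

theorem length_of_mem_paths {ms : List Column} {s : Column} {p : List Column × Column}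
    (hp : p ∈ paths ms s) : p.1.length = ms.length := by
  induction ms generalizing s p with
  | nil => simp_all [paths]
  | cons m ms ih =>
    simp only [paths, List.mem_flatMap, List.mem_map] at hp
    obtain ⟨c, -, q, hq, rfl⟩ := hp
    simp [ih hq]

theorem foldl_of_mem_paths {ms : List Column} {s : Column} {p : List Column × Column}
    (hp : p ∈ paths ms s) : p.1.foldl nextState s = p.2 := by
  induction ms generalizing s p with
  | nil => simp_all [paths]
  | cons m ms ih =>
    simp only [paths, List.mem_flatMap, List.mem_map] at hp
    obtain ⟨c, -, q, hq, rfl⟩ := hp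
    simp [ih hq]

theorem exactlyOne_of_mem_paths {ms : List Column} {s : Column} {p : List Column × Column}
    (hp : p ∈ paths ms s) {k : ℕ} {c : Column} (hk : p.1[k]? = some c) :
    ExactlyOne (c.1 = true) (((p.1.take k).foldl nextState s).1 = true) (c.2.2 = true) ∧
    ExactlyOne (c.2.1 = true) (((p.1.take k).foldl nextState s).2.2 = true) (c.2.2 = true) := by
  induction ms generalizing s p k with
  | nil => simp_all [paths]
  | cons m ms ih =>
    simp only [paths, List.mem_flatMap, List.mem_map] at hp
    obtain ⟨d, hd, q, hq, rfl⟩ := hp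
    rw [mem_nextColumns] at hd
    cases k with
    | zero =>
      obtain rfl : d = c := by simpa using hk
      exact ⟨hd.1, hd.2.1⟩
    | succ k => simpa using ih hq (k := k) (by simpa using hk)

variable {n : ℕ}

/-- The edges of a column at position `i`. -/
def columnEdges (i : ZMod n) (c : Column) : Set (Sym2 (PV n)) :=
  {e | c.1 = true ∧ e = s(pu i, pu (i + 2))} ∪ {e | c.2.1 = true ∧ e = s(pv i, pv (i + 1))} ∪
    {e | c.2.2 = true ∧ e = s(pu i, pv i)}

/-- The edges of a sequence of columns starting at position `i`. -/
def columnsEdges : ZMod n → List Column → Set (Sym2 (PV n))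
  | _, [] => ∅
  | i, c :: cs => columnEdges i c ∪ columnsEdges (i + 1) cs

theorem columnsEdges_append (i : ZMod n) (cs ds : List Column) :
    columnsEdges i (cs ++ ds) = columnsEdges i cs ∪ columnsEdges (i + cs.length) ds := by
  induction cs generalizing i with
  | nil => simp [columnsEdges]
  | cons c cs ih => simp [columnsEdges, ih, Set.union_assoc, add_assoc, add_comm (1 : ZMod n)]

theorem columnsEdges_subset_of_mem_paths {ms : List Column} {s : Column} {p : List Column × Column}
    (hp : p ∈ paths ms s) (i : ZMod n) : columnsEdges i ms ⊆ columnsEdges i p.1 := by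
  induction ms generalizing s p i with
  | nil => exact Set.empty_subset _
  | cons m ms ih =>
    simp only [paths, List.mem_flatMap, List.mem_map] at hp
    obtain ⟨c, hc, q, hq, rfl⟩ := hp
    rw [mem_nextColumns] at hc
    refine Set.union_subset_union ?_ (ih hq (i + 1))
    exact Set.union_subset_union (Set.union_subset_union (fun e he => ⟨hc.2.2.1 he.1, he.2⟩)
      fun e he => ⟨hc.2.2.2.1 he.1, he.2⟩) fun e he => ⟨hc.2.2.2.2 he.1, he.2⟩

/-- The number of edges of a column. -/
def columnWeight (c : Column) : ℕ := c.1.toNat + c.2.1.toNat + c.2.2.toNat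

theorem finite_and_ncard_le {α : Type*} (b : Bool) (a : α) :
    {e | b = true ∧ e = a}.Finite ∧ {e | b = true ∧ e = a}.ncard ≤ b.toNat := by
  cases b <;> simp

theorem ncard_columnsEdges_le (i : ZMod n) (cs : List Column) :
    (columnsEdges i cs).ncard ≤ (cs.map columnWeight).sum := by
  induction cs generalizing i with
  | nil => simp [columnsEdges]
  | cons c cs ih =>
    rw [columnsEdges, List.map_cons, List.sum_cons]
    refine (Set.ncard_union_le _ _).trans (Nat.add_le_add ?_ (ih _))
    refine (Set.ncard_union_le _ _).trans (Nat.add_le_add ?_ (finite_and_ncard_le _ _).2)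
    exact (Set.ncard_union_le _ _).trans
      (Nat.add_le_add (finite_and_ncard_le _ _).2 (finite_and_ncard_le _ _).2)

/-- The `k` values of `C` starting at position `i`. -/
def readColumns (C : ZMod n → Column) : ZMod n → ℕ → List Column
  | _, 0 => []
  | i, k + 1 => C i :: readColumns C (i + 1) k

theorem mem_columnsEdges_readColumns (C : ZMod n → Column) (i : ZMod n) (k : ℕ)
    (e : Sym2 (PV n)) :
    e ∈ columnsEdges i (readColumns C i k) ↔
      ∃ j : ℕ, j < k ∧ e ∈ columnEdges (i + (j : ZMod n)) (C (i + j)) := by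
  induction k generalizing i with
  | zero => simp [readColumns, columnsEdges]
  | succ k ih =>
    rw [readColumns, columnsEdges, Set.mem_union, ih, Nat.exists_lt_succ_left]
    simp [add_assoc, add_comm (1 : ZMod n)]

theorem mem_columnsEdges_readColumns_zero [NeZero n] (C : ZMod n → Column) (e : Sym2 (PV n)) :
    e ∈ columnsEdges 0 (readColumns C 0 n) ↔ ∃ i, e ∈ columnEdges i (C i) := by
  rw [mem_columnsEdges_readColumns]
  constructor
  · rintro ⟨j, -, h⟩
    exact ⟨_, h⟩
  · rintro ⟨i, h⟩
    exact ⟨i.val, i.val_lt, by simpa using h⟩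

theorem getElem?_readColumns (C : ZMod n → Column) (i : ZMod n) {j k : ℕ} (hj : j < k) :
    (readColumns C i k)[j]? = some (C (i + j)) := by
  induction k generalizing i j with
  | zero => omega
  | succ k ih =>
    cases j with
    | zero => simp [readColumns]
    | succ j => simp [readColumns, ih (i + 1) (by omega : j < k), add_assoc, add_comm (1 : ZMod n)]

theorem length_readColumns (C : ZMod n → Column) (i : ZMod n) (k : ℕ) :
    (readColumns C i k).length = k := by
  induction k generalizing i with
  | zero => rfl
  | succ k ih => simp [readColumns, ih]

open Classical in
/-- The columns of a set of edges. -/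
noncomputable def edgeColumn (E : Set (Sym2 (PV n))) (i : ZMod n) : Column :=
  (decide (s(pu i, pu (i + 2)) ∈ E), decide (s(pv i, pv (i + 1)) ∈ E), decide (s(pu i, pv i) ∈ E))

theorem columnsEdges_edgeColumn (hn : 11 ≤ n) (M : (petersen n).Subgraph) :
    columnsEdges 0 (readColumns (edgeColumn M.edgeSet) 0 n) = M.edgeSet := by
  have : NeZero n := ⟨by omega⟩
  ext e
  rw [mem_columnsEdges_readColumns_zero]
  constructor
  · rintro ⟨i, (⟨h, rfl⟩ | ⟨h, rfl⟩) | ⟨h, rfl⟩⟩ <;> simpa [edgeColumn] using h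
  · intro he
    obtain ⟨i, rfl | rfl | rfl⟩ := petersen_edge_cases hn (M.edgeSet_subset he)
    · exact ⟨i, Or.inl (Or.inl ⟨by simpa [edgeColumn] using he, rfl⟩)⟩
    · exact ⟨i, Or.inl (Or.inr ⟨by simpa [edgeColumn] using he, rfl⟩)⟩
    · exact ⟨i, Or.inr ⟨by simpa [edgeColumn] using he, rfl⟩⟩

/-- The state before position `i` in the cyclic sequence of columns `C`. -/
def columnState (C : ZMod n → Column) (i : ZMod n) : Column :=
  ((C (i - 2)).1, (C (i - 1)).1, (C (i - 1)).2.1)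

theorem nextState_columnState (C : ZMod n → Column) (i : ZMod n) :
    nextState (columnState C i) (C i) = columnState C (i + 1) := by
  simp [nextState, columnState, show i + 1 - 2 = i - 1 by ring]

theorem readColumns_mem_paths (hn : 11 ≤ n) {M : (petersen n).Subgraph} (hM : M.IsPerfectMatching)
    {ms : List Column} {i : ZMod n} (h : columnsEdges i ms ⊆ M.edgeSet) :
    (readColumns (edgeColumn M.edgeSet) i ms.length,
      columnState (edgeColumn M.edgeSet) (i + ms.length)) ∈
        paths ms (columnState (edgeColumn M.edgeSet) i) := by
  rw [isPerfectMatching_iff_isConfig hn] at hM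
  induction ms generalizing i with
  | nil => simp [paths, readColumns]
  | cons m ms ih =>
    simp only [paths, List.mem_flatMap, List.mem_map]
    rw [columnsEdges, Set.union_subset_iff] at h
    refine ⟨edgeColumn M.edgeSet i, ?_, (_, _), by
      rw [nextState_columnState]
      exact ih h.2, ?_⟩
    rotate_left
    · simp [readColumns, add_assoc, add_comm (1 : ZMod n)]
    · rw [mem_nextColumns]
      have hc := hM i
      refine ⟨?_, ?_, fun hm => ?_, fun hm => ?_, fun hm => ?_⟩
      · simpa [edgeColumn, columnState] using hc.1
      · simpa [edgeColumn, columnState] using hc.2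
      · simpa [edgeColumn] using h.1 (Or.inl (Or.inl ⟨hm, rfl⟩))
      · simpa [edgeColumn] using h.1 (Or.inl (Or.inr ⟨hm, rfl⟩))
      · simpa [edgeColumn] using h.1 (Or.inr ⟨hm, rfl⟩)

theorem exists_isPerfectMatching_of_mem_paths (hn : 11 ≤ n) {ms cs : List Column} {s : Column}
    (hlen : ms.length = n) (h : (cs, s) ∈ paths ms s) :
    ∃ M : (petersen n).Subgraph, M.IsPerfectMatching ∧ M.edgeSet = columnsEdges 0 cs := by
  have : NeZero n := ⟨by omega⟩
  have hcs : cs.length = n := (length_of_mem_paths h).trans hlen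
  obtain ⟨C, hC⟩ : ∃ C : ZMod n → Column, readColumns C 0 n = cs := by
    refine ⟨fun i => cs.getD i.val default, List.ext_getElem? fun k => ?_⟩
    by_cases hk : k < n
    · rw [getElem?_readColumns _ _ hk]
      simp [ZMod.val_cast_of_lt hk, hcs, hk]
    · rw [List.getElem?_eq_none (by rw [length_readColumns]; omega),
        List.getElem?_eq_none (by omega)]
  have hval : ∀ i : ZMod n, cs[i.val]? = some (C i) := fun i => by
    rw [← hC, getElem?_readColumns _ _ i.val_lt]
    simp
  have hstep : ∀ i : ZMod n, (cs.take (i + 1).val).foldl nextState s =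
      nextState ((cs.take i.val).foldl nextState s) (C i) := fun i => by
    have e : (cs.take (i.val + 1)).foldl nextState s =
        nextState ((cs.take i.val).foldl nextState s) (C i) := by
      rw [List.take_add_one, hval]
      simp
    rw [← e]
    by_cases hi : i.val + 1 < n
    · rw [ZMod.val_add_of_lt] <;> rw [ZMod.val_one'' (by omega)]
      exact hi
    · have hi' : i.val + 1 = n := by have := i.val_lt; omega
      have h0 : i + 1 = 0 := by
        have := congrArg (Nat.cast : ℕ → ZMod n) hi'
        simpa using this
      rw [h0, hi', ← hcs, List.take_length, foldl_of_mem_paths h]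
      simp
  have h1 : ∀ i : ZMod n,
      ((cs.take i.val).foldl nextState s).2 = ((C (i - 1)).1, (C (i - 1)).2.1) :=
    fun i => by
      have := hstep (i - 1)
      rw [sub_add_cancel] at this
      rw [this]
      rfl
  have h2 : ∀ i : ZMod n, ((cs.take i.val).foldl nextState s).1 = (C (i - 2)).1 := fun i => by
    have := hstep (i - 1)
    rw [sub_add_cancel] at this
    rw [this, nextState, h1, show i - 1 - 1 = i - 2 by ring]
  have hconf : IsConfig (fun i => (C i).1 = true) (fun i => (C i).2.1 = true)
      (fun i => (C i).2.2 = true) := fun i => by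
    have := exactlyOne_of_mem_paths h (hval i)
    rwa [h1, h2] at this
  refine ⟨_, configSubgraph_isPerfectMatching hn hconf, ?_⟩
  rw [← columnsEdges_edgeColumn hn, ← hC]
  congr
  funext i
  ext <;> simp [edgeColumn, configSubgraph_adj_u hn, configSubgraph_adj_v hn,
    configSubgraph_adj_z hn]

theorem exists_forcingNumber_le (hn : 11 ≤ n) {ms cs : List Column} {s : Column}
    (hlen : ms.length = n) (hpath : paths ms s = [(cs, s)])
    (hs : ∀ s', ∀ p ∈ paths ms s', p.2 = s' → s' = s) :
    ∃ M : (petersen n).Subgraph, M.IsPerfectMatching ∧ M.edgeSet = columnsEdges 0 cs ∧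
      forcingNumber (petersen n) M ≤ (ms.map columnWeight).sum := by
  have hmem : (cs, s) ∈ paths ms s := by simp [hpath]
  obtain ⟨M, hM, hE⟩ := exists_isPerfectMatching_of_mem_paths hn hlen hmem
  refine ⟨M, hM, hE, le_trans (Nat.sInf_le ⟨columnsEdges 0 ms, ⟨?_, ?_⟩, rfl⟩)
    (ncard_columnsEdges_le 0 ms)⟩
  · rw [hE]
    exact columnsEdges_subset_of_mem_paths hmem 0
  · intro M' hM' hsub
    have hr := readColumns_mem_paths hn hM' hsub
    have h0 := hs _ _ hr (by simp [hlen])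
    rw [h0, hpath, List.mem_singleton, Prod.mk.injEq, hlen] at hr
    apply IsPerfectMatching.eq_of_edgeSet_subset hM hM'
    rw [← columnsEdges_edgeColumn hn M', hr.1, hE]

/-- The blocks used in the extremal matchings: `a₀` and `a₁` are blocks `A` with the edge
`v_i v_{i+1}`, respectively `v_{i+2} v_{i+3}`, marked, and `b₀` and `b₁` are blocks `B` with no
edge, respectively the spoke, marked. -/
inductive MarkedBlock
  | a₀ | a₁ | b₀ | b₁

namespace MarkedBlock

/-- Whether a marked block is a block `A`. -/
def isA : MarkedBlock → Bool
  | a₀ | a₁ => true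
  | b₀ | b₁ => false

/-- The columns of a marked block. -/
def columns : MarkedBlock → List Column
  | a₀ | a₁ => [(true, true, false), (true, false, false), (false, true, false),
      (false, false, false)]
  | b₀ | b₁ => [(false, false, true)]

/-- The marked edges of a marked block. -/
def masks : MarkedBlock → List Column
  | a₀ => [(false, true, false), (false, false, false), (false, false, false),
      (false, false, false)]
  | a₁ => [(false, false, false), (false, false, false), (false, true, false),
      (false, false, false)]
  | b₀ => [(false, false, false)]
  | b₁ => [(false, false, true)]

theorem columnsEdges_flatMap_columns (w : List MarkedBlock) (i : ZMod n) :
    columnsEdges i (w.flatMap columns) = abEdges n i (w.map isA) := by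
  induction w generalizing i with
  | nil => rfl
  | cons c w ih =>
    rw [List.flatMap_cons, columnsEdges_append, ih]
    have e : i + 1 + 1 = i + 2 := by ring
    have e' : i + 2 + 1 = i + 3 := by ring
    have e'' : i + 1 + 2 = i + 3 := by ring
    cases c <;> simp only [List.map_cons, isA, abEdges, columns] <;> congr 1 <;> ext x <;>
      simp [columnsEdges, columnEdges, blockA, blockB, e, e', e''] <;> tauto

theorem sum_abLen (w : List MarkedBlock) :
    ((w.map isA).map abLen).sum = (w.flatMap masks).length := by
  induction w with
  | nil => rfl
  | cons c w ih =>
    simp only [List.map_cons, List.sum_cons, ih, List.flatMap_cons, List.length_append]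
    cases c <;> rfl

/-- The periodic part of the extremal matchings. -/
def period : List MarkedBlock := [b₀, b₀, b₀, a₁, b₀, a₀]

/-- The initial part of the extremal matching for `n = 11 + r + 12 m`. -/
def initial : ℕ → List MarkedBlock
  | 0 => [b₀, b₁, a₁, b₀, a₀]
  | 1 => [b₀, b₀, b₁, a₁, b₀, a₀]
  | 2 => [b₁, b₀, b₀, b₀, a₁, b₀, a₀]
  | 3 => [b₀, b₁, b₀, b₀, b₀, a₁, b₀, a₀]
  | 4 => [b₀, b₀, b₁, b₀, b₀, b₀, a₁, b₀, a₀]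
  | 5 => [b₀, b₀, b₀, b₁, b₀, b₀, b₀, a₁, b₀, a₀]
  | 6 => [b₁, b₀, b₀, b₀, a₁, b₀, a₀, a₀]
  | 7 => [b₁, b₀, b₀, b₀, a₁, b₀, a₀, b₀, a₀]
  | 8 => [b₀, b₁, b₀, b₀, b₀, a₁, b₀, a₀, b₀, a₀]
  | 9 => [b₀, b₀, b₁, b₀, b₀, b₀, a₁, b₀, a₀, b₀, a₀]
  | 10 => [b₀, b₀, b₀, b₁, b₀, b₀, b₀, a₁, b₀, a₀, b₀, a₀]
  | _ => [b₀, a₀, b₀, b₀, b₀, a₁, b₀, a₁, b₀, a₀]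

/-- The extremal matching for `n = 11 + r + 12 m`. -/
def extremal (r m : ℕ) : List MarkedBlock :=
  initial r ++ (List.replicate m period).flatten

/-- The possible states after the initial part. -/
def endStates : List Column :=
  [(false, false, false), (true, false, false), (false, false, true)]

theorem paths_initial : ∀ r < 12, paths ((initial r).flatMap masks) (false, false, false) =
    [((initial r).flatMap columns, (false, false, false))] := by
  intro r hr
  interval_cases r <;> decide

theorem snd_mem_endStates_of_mem_paths_initial : ∀ r < 12, ∀ s,
    ∀ p ∈ paths ((initial r).flatMap masks) s, p.2 ∈ endStates := by
  decide

theorem snd_of_mem_paths_initial : ∀ r < 12, ∀ s ∈ endStates,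
    ∀ p ∈ paths ((initial r).flatMap masks) s, p.2 = (false, false, false) := by
  intro r hr
  interval_cases r <;> decide

theorem paths_period : paths (period.flatMap masks) (false, false, false) =
    [(period.flatMap columns, (false, false, false))] := by
  decide

theorem snd_mem_endStates_of_mem_paths_period : ∀ s ∈ endStates,
    ∀ p ∈ paths (period.flatMap masks) s, p.2 ∈ endStates := by
  decide

theorem paths_replicate_period (m : ℕ) :
    paths ((List.replicate m period).flatten.flatMap masks) (false, false, false) =
      [((List.replicate m period).flatten.flatMap columns, (false, false, false))] := by
  induction m with
  | zero => rfl
  | succ m ih =>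
    simp [List.replicate_succ, List.flatMap_append, paths_append, paths_period, ih]

theorem snd_mem_endStates_of_mem_paths_replicate {m : ℕ} {s : Column} (hs : s ∈ endStates)
    {p : List Column × Column}
    (hp : p ∈ paths ((List.replicate m period).flatten.flatMap masks) s) :
    p.2 ∈ endStates := by
  induction m generalizing s p with
  | zero =>
    obtain rfl : p = ([], s) := by simpa [paths] using hp
    exact hs
  | succ m ih =>
    rw [List.replicate_succ, List.flatten_cons, List.flatMap_append, paths_append,
      List.mem_flatMap] at hp
    obtain ⟨q, hq, hp⟩ := hp
    obtain ⟨p', hp', rfl⟩ := List.mem_map.1 hp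
    exact ih (p := p') (snd_mem_endStates_of_mem_paths_period s hs q hq) hp'

theorem paths_extremal {r : ℕ} (hr : r < 12) (m : ℕ) :
    paths ((extremal r m).flatMap masks) (false, false, false) =
      [((extremal r m).flatMap columns, (false, false, false))] := by
  simp [extremal, List.flatMap_append, paths_append, paths_initial r hr, paths_replicate_period]

theorem eq_of_mem_paths_extremal {r : ℕ} (hr : r < 12) (m : ℕ) {s : Column}
    {p : List Column × Column} (hp : p ∈ paths ((extremal r m).flatMap masks) s) (hs : p.2 = s) :
    s = (false, false, false) := by
  rw [extremal, List.flatMap_append, paths_append, List.mem_flatMap] at hp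
  obtain ⟨q, hq, hp⟩ := hp
  obtain ⟨p', hp', rfl⟩ := List.mem_map.1 hp
  have h1 := snd_mem_endStates_of_mem_paths_replicate
    (snd_mem_endStates_of_mem_paths_initial r hr s q hq) hp'
  have h2 := snd_of_mem_paths_initial r hr s (hs ▸ h1) q hq
  rw [h2, paths_replicate_period, List.mem_singleton] at hp'
  rw [← hs, hp']

theorem length_masks_extremal {r : ℕ} (hr : r < 12) (m : ℕ) :
    ((extremal r m).flatMap masks).length = 11 + r + 12 * m := by
  have h1 : ∀ r < 12, ((initial r).flatMap masks).length = 11 + r := by decide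
  have h2 : ((List.replicate m period).flatten.flatMap masks).length = 12 * m := by
    induction m with
    | zero => rfl
    | succ m ih =>
      rw [List.replicate_succ, List.flatten_cons, List.flatMap_append, List.length_append, ih,
        mul_add, add_comm]
      rfl
  rw [extremal, List.flatMap_append, List.length_append, h1 r hr, h2]

theorem sum_columnWeight_extremal {r : ℕ} (hr : r < 12) (m : ℕ) :
    (((extremal r m).flatMap masks).map columnWeight).sum = 3 + r / 6 + 2 * m := by
  have h1 : ∀ r < 12, (((initial r).flatMap masks).map columnWeight).sum = 3 + r / 6 := by decide
  have h2 : (((List.replicate m period).flatten.flatMap masks).map columnWeight).sum = 2 * m := by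
    induction m with
    | zero => rfl
    | succ m ih =>
      rw [List.replicate_succ, List.flatten_cons, List.flatMap_append, List.map_append,
        List.sum_append, ih, mul_add, add_comm]
      rfl
  rw [extremal, List.flatMap_append, List.map_append, List.sum_append, h1 r hr, h2]

end MarkedBlock

open MarkedBlock in
theorem exists_isType1_forcingNumber_le (hn : 11 ≤ n) :
    ∃ M : (petersen n).Subgraph, M.IsPerfectMatching ∧ IsType1 M ∧
      forcingNumber (petersen n) M ≤ (n + 7) / 6 := by
  have hr : (n - 11) % 12 < 12 := Nat.mod_lt _ (by norm_num)
  have hlen := length_masks_extremal hr ((n - 11) / 12)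
  have hsum := sum_columnWeight_extremal hr ((n - 11) / 12)
  rw [show 11 + (n - 11) % 12 + 12 * ((n - 11) / 12) = n by omega] at hlen
  obtain ⟨M, hM, hE, hf⟩ := exists_forcingNumber_le hn hlen (paths_extremal hr _)
    fun _ _ hp hs => eq_of_mem_paths_extremal hr _ hp hs
  refine ⟨M, hM, ⟨0, _, (sum_abLen _).trans hlen, ?_⟩, hf.trans (by omega)⟩
  rw [hE, columnsEdges_flatMap_columns]

end UpperBound

/-- for `n ≥ 11` the minimum forcing number over type-1 perfect matchings
of `P(n,2)` equals `⌈(n+2)/6⌉` (written `(n+7)/6` in natural division). -/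
theorem type1_min_forcing (n : ℕ) (hn : 11 ≤ n) :
    IsLeast {k | ∃ M : (petersen n).Subgraph,
        M.IsPerfectMatching ∧ IsType1 M ∧ forcingNumber (petersen n) M = k}
      ((n + 7) / 6) := by
  refine ⟨?_, ?_⟩
  · obtain ⟨M, hM, h1, hle⟩ := exists_isType1_forcingNumber_le hn
    have := add_two_le_six_mul_forcingNumber hn hM h1
    exact ⟨M, hM, h1, by omega⟩
  · rintro _ ⟨M, hM, h1, rfl⟩
    have := add_two_le_six_mul_forcingNumber hn hM h1
    omega
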